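/- arXiv:2602.12471 — 4 statements merged into one kernel-verified Lean document; each statement's English description precedes it below -/
import Mathlib

section
/- Suppose d = 2 and η ≥ η₀ = max(n, (32/γ²)·log(256/γ²)). Then the transition time τ = min{t ≥ 0 : F(w_t) ≤ 1/(8η)} of gradient descent is finite and satisfies τ ≤ 2 + 4n/γ + (142/γ²)·log(2/γ²). Moreover, F(w_t) ≤ 1/(8η) for all t ≥ τ, and F(w_t) ≤ 8/(η·γ²·(t − τ)) for all t > τ. -/
open scoped InnerProductSpace BigOperators
open Finset

/-- Logistic loss `F(w) = (1/n) ∑ᵢ log(1 + exp(−⟨w, xᵢ⟩))`. -/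
noncomputable def logisticLoss (n : ℕ) (x : Fin n → EuclideanSpace ℝ (Fin 2))
    (w : EuclideanSpace ℝ (Fin 2)) : ℝ :=
  (n : ℝ)⁻¹ * ∑ i, Real.log (1 + Real.exp (-⟪w, x i⟫_ℝ))

/-- Gradient descent iterates: `w₀ = 0`, `w_{t+1} = w_t − η ∇F(w_t)`
(the gradient of the logistic loss is written in closed form). -/
noncomputable def gdIter (n : ℕ) (x : Fin n → EuclideanSpace ℝ (Fin 2)) (η : ℝ) :
    ℕ → EuclideanSpace ℝ (Fin 2)
  | 0 => 0
  | t + 1 => gdIter n x η t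
      + (η / n) • ∑ i, (Real.exp ⟪gdIter n x η t, x i⟫_ℝ + 1)⁻¹ • x i

/-- `γ` is the maximum margin of the dataset `x`:
it is the greatest `m` such that some unit vector `w` satisfies `⟨w, xᵢ⟩ ≥ m` for all `i`. -/
def isMaxMargin (n : ℕ) (x : Fin n → EuclideanSpace ℝ (Fin 2)) (γ : ℝ) : Prop :=
  IsGreatest {m : ℝ | ∃ w : EuclideanSpace ℝ (Fin 2), ‖w‖ = 1 ∧ ∀ i, m ≤ ⟪w, x i⟫_ℝ} γ

/-- Data in orthonormal coordinates: `a i` along a separating direction with margin `γ`, `b i`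
orthogonal to it, together with the largeness conditions on the step size `η`. -/
structure SeparatedPlanarData (n : ℕ) (a b : Fin n → ℝ) (γ η : ℝ) : Prop where
  n_pos : 0 < n
  margin_le : ∀ i, γ ≤ a i
  abs_le_one : ∀ i, |b i| ≤ 1
  margin_pos : 0 < γ
  margin_lt_one : γ < 1
  n_le : (n : ℝ) ≤ η
  one_le : 1 ≤ η
  log_bound : 9 * η ≤ Real.exp (η * γ ^ 2 / 16)
  exp_bound : Real.exp (-(η * γ ^ 2 / 2)) ≤ γ ^ 2 / (72 * η ^ 2)

/-- The margin of the `i`-th point at the iterate `η • (p, q)`. -/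
def planarMargin {n : ℕ} (a b : Fin n → ℝ) (η p q : ℝ) (i : Fin n) : ℝ :=
  η * (p * a i + q * b i)

/-- The logistic weight of the `i`-th point at the iterate `η • (p, q)`. -/
noncomputable def planarWeight {n : ℕ} (a b : Fin n → ℝ) (η p q : ℝ) (i : Fin n) : ℝ :=
  (Real.exp (planarMargin a b η p q i) + 1)⁻¹

/-- The points whose orthogonal coordinate opposes that of the iterate. -/
noncomputable def opposing {n : ℕ} (b : Fin n → ℝ) (q : ℝ) : Finset (Fin n) :=
  univ.filter fun i => q * b i < 0

/-- The average exponential loss carried by the opposing points. -/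
noncomputable def opposingExp {n : ℕ} (a b : Fin n → ℝ) (η p q : ℝ) : ℝ :=
  (n : ℝ)⁻¹ * ∑ i ∈ opposing b q, Real.exp (-planarMargin a b η p q i)

/-- The average logistic weight carried by the opposing points. -/
noncomputable def opposingWeight {n : ℕ} (a b : Fin n → ℝ) (η p q : ℝ) : ℝ :=
  (n : ℝ)⁻¹ * ∑ i ∈ opposing b q, planarWeight a b η p q i

/-- The logistic loss at the iterate `η • (p, q)`. -/
noncomputable def planarLoss {n : ℕ} (a b : Fin n → ℝ) (η p q : ℝ) : ℝ :=
  (n : ℝ)⁻¹ * ∑ i, Real.log (1 + Real.exp (-planarMargin a b η p q i))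

theorem planarWeight_pos {n : ℕ} (a b : Fin n → ℝ) (η p q : ℝ) (i : Fin n) :
    0 < planarWeight a b η p q i := by
  unfold planarWeight; positivity

theorem planarWeight_le_one {n : ℕ} (a b : Fin n → ℝ) (η p q : ℝ) (i : Fin n) :
    planarWeight a b η p q i ≤ 1 := by
  unfold planarWeight
  exact inv_le_one_of_one_le₀ (by linarith [Real.exp_pos (planarMargin a b η p q i)])

theorem planarWeight_le_exp {n : ℕ} (a b : Fin n → ℝ) (η p q : ℝ) (i : Fin n) :
    planarWeight a b η p q i ≤ Real.exp (-planarMargin a b η p q i) := by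
  unfold planarWeight
  rw [Real.exp_neg]
  exact inv_anti₀ (Real.exp_pos _) (by linarith)

theorem average_le_of_le {n : ℕ} (hn : 0 < n) (s : Finset (Fin n)) (f : Fin n → ℝ) {c : ℝ}
    (hc : 0 ≤ c) (h : ∀ i ∈ s, f i ≤ c) : (n : ℝ)⁻¹ * ∑ i ∈ s, f i ≤ c := by
  have hn' : (0 : ℝ) < n := by exact_mod_cast hn
  have h1 : ∑ i ∈ s, f i ≤ s.card • c := Finset.sum_le_card_nsmul _ _ _ h
  have h2 : (s.card : ℝ) ≤ n := by
    exact_mod_cast (Finset.card_le_univ s).trans (by simp)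
  rw [inv_mul_le_iff₀ hn']
  rw [nsmul_eq_mul] at h1
  nlinarith

theorem opposingWeight_le_one {n : ℕ} (hn : 0 < n) (a b : Fin n → ℝ) (η p q : ℝ) :
    opposingWeight a b η p q ≤ 1 :=
  average_le_of_le hn _ _ zero_le_one fun i _ => planarWeight_le_one a b η p q i

theorem opposingWeight_le_average {n : ℕ} (a b : Fin n → ℝ) (η p q : ℝ) :
    opposingWeight a b η p q ≤ (n : ℝ)⁻¹ * ∑ i, planarWeight a b η p q i := by
  unfold opposingWeight
  gcongr
  · exact fun i _ _ => (planarWeight_pos a b η p q i).le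
  · exact Finset.subset_univ _

namespace SeparatedPlanarData

variable {n : ℕ} {a b : Fin n → ℝ} {γ η p q p' q' : ℝ}

theorem exp_neg_margin_le (S : SeparatedPlanarData n a b γ η) (hp : γ / 2 ≤ p) {i : Fin n}
    (hi : i ∉ opposing b q) :
    Real.exp (-planarMargin a b η p q i) ≤ γ ^ 2 / (72 * η ^ 2) := by
  refine le_trans (Real.exp_le_exp.2 ?_) S.exp_bound
  simp only [opposing, mem_filter, mem_univ, true_and, not_lt] at hi
  have h1 := S.margin_pos
  have h2 := S.one_le
  have h3 : γ / 2 * γ ≤ p * a i := mul_le_mul hp (S.margin_le i) h1.le (by linarith)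
  unfold planarMargin
  nlinarith

theorem opposingExp_gt (S : SeparatedPlanarData n a b γ η) (hp : γ / 2 ≤ p)
    (hF : 1 / (8 * η) < planarLoss a b η p q) : 1 / (9 * η) < opposingExp a b η p q := by
  have hη := S.one_le
  have hγ := S.margin_pos
  have hγ' := S.margin_lt_one
  have hn' : (0 : ℝ) < n := by exact_mod_cast S.n_pos
  have h1 : planarLoss a b η p q ≤ (n : ℝ)⁻¹ * ∑ i, Real.exp (-planarMargin a b η p q i) := by
    unfold planarLoss
    gcongr with i
    have := Real.log_le_sub_one_of_pos
      (by positivity : 0 < 1 + Real.exp (-planarMargin a b η p q i))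
    linarith
  have h2 : (n : ℝ)⁻¹ * ∑ i ∈ (opposing b q)ᶜ, Real.exp (-planarMargin a b η p q i)
      ≤ γ ^ 2 / (72 * η ^ 2) :=
    average_le_of_le S.n_pos _ _ (by positivity)
      fun i hi => S.exp_neg_margin_le hp (Finset.mem_compl.1 hi)
  rw [← Finset.sum_add_sum_compl (opposing b q), mul_add] at h1
  have h3 : γ ^ 2 / (72 * η ^ 2) ≤ 1 / (72 * η) := by
    rw [div_le_div_iff₀ (by positivity) (by positivity)]
    have : γ ^ 2 ≤ 1 := by nlinarith
    nlinarith [mul_le_mul this hη zero_le_one zero_le_one,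
      mul_pos (by linarith : 0 < η) (by linarith : 0 < η)]
  have h4 : 1 / (8 * η) = 1 / (9 * η) + 1 / (72 * η) := by
    field_simp; norm_num
  unfold opposingExp
  linarith

theorem exists_opposing_margin_le (S : SeparatedPlanarData n a b γ η) (hp : γ / 2 ≤ p)
    (hF : 1 / (8 * η) < planarLoss a b η p q) :
    ∃ i, q * b i < 0 ∧ 1 / (9 * η) < Real.exp (-planarMargin a b η p q i) := by
  have hη := S.one_le
  by_contra! h
  have := S.opposingExp_gt hp hF
  refine absurd this (not_lt.2 ?_)
  refine average_le_of_le S.n_pos _ _ (by positivity) fun i hi => h i ?_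
  simpa [opposing] using hi

theorem mul_margin_le_neg (S : SeparatedPlanarData n a b γ η) (hp : γ / 2 ≤ p) {i : Fin n}
    (hi : 1 / (9 * η) < Real.exp (-planarMargin a b η p q i)) :
    7 / 8 * (p * γ) ≤ -(q * b i) := by
  have hη := S.one_le
  have hγ := S.margin_pos
  have h1 : Real.exp (-(η * γ ^ 2 / 16)) ≤ 1 / (9 * η) := by
    rw [Real.exp_neg, ← one_div]
    exact one_div_le_one_div_of_le (by positivity) S.log_bound
  have h2 := Real.exp_lt_exp.1 (h1.trans_lt hi)
  unfold planarMargin at h2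
  have h3 : p * a i + q * b i ≤ γ ^ 2 / 16 := by
    by_contra! h
    have := mul_lt_mul_of_pos_left h (by linarith : 0 < η)
    linarith
  have h4 : p * γ ≤ p * a i := mul_le_mul_of_nonneg_left (S.margin_le i) (by linarith)
  nlinarith

theorem abs_ge (S : SeparatedPlanarData n a b γ η) (hp : γ / 2 ≤ p)
    (hF : 1 / (8 * η) < planarLoss a b η p q) : 7 / 8 * (p * γ) ≤ |q| := by
  obtain ⟨i, -, hi⟩ := S.exists_opposing_margin_le hp hF
  have h1 := S.mul_margin_le_neg hp hi
  have h2 : -(q * b i) ≤ |q| * |b i| := by rw [← abs_mul]; exact neg_le_abs _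
  have h3 := S.abs_le_one i
  nlinarith [abs_nonneg q]

/-- The change of `q ^ 2` to first order, up to the negligible non-opposing points. -/
theorem drift_le (S : SeparatedPlanarData n a b γ η) (hp : γ / 2 ≤ p) (hq : |q| ≤ 1)
    (hq' : q' = q + (n : ℝ)⁻¹ * ∑ i, planarWeight a b η p q i * b i) {j : Fin n}
    (hj : q * b j < 0) :
    q * (q' - q) ≤ γ ^ 2 / (72 * η ^ 2) + (n : ℝ)⁻¹ * (planarWeight a b η p q j * (q * b j)) := by
  have hη := S.one_le
  have e : q * (q' - q) = (n : ℝ)⁻¹ * ∑ i, planarWeight a b η p q i * (q * b i) := by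
    rw [hq', Finset.mul_sum, add_sub_cancel_left, Finset.mul_sum, Finset.mul_sum]
    exact Finset.sum_congr rfl fun i _ => by ring
  rw [e, ← Finset.sum_add_sum_compl (opposing b q), mul_add, add_comm]
  refine add_le_add ?_ ?_
  · refine average_le_of_le S.n_pos _ _ (by positivity) fun i hi => ?_
    have h1 := S.exp_neg_margin_le hp (Finset.mem_compl.1 hi)
    have h2 := (planarWeight_le_exp a b η p q i).trans h1
    have h3 : q * b i ≤ 1 := by
      refine (le_abs_self _).trans ?_
      rw [abs_mul]
      exact mul_le_one₀ hq (abs_nonneg _) (S.abs_le_one i)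
    nlinarith [planarWeight_pos a b η p q i]
  · refine mul_le_mul_of_nonneg_left ?_ (by positivity)
    have hmem : j ∈ opposing b q := by simpa [opposing] using hj
    rw [← Finset.add_sum_erase _ _ hmem]
    have : ∑ i ∈ (opposing b q).erase j, planarWeight a b η p q i * (q * b i) ≤ 0 := by
      refine Finset.sum_nonpos fun i hi => ?_
      have h : q * b i < 0 := by simpa [opposing] using Finset.mem_of_mem_erase hi
      nlinarith [planarWeight_pos a b η p q i]
    linarith

theorem drift_ge (S : SeparatedPlanarData n a b γ η)
    (hq' : q' = q + (n : ℝ)⁻¹ * ∑ i, planarWeight a b η p q i * b i) :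
    -(|q| * opposingWeight a b η p q) ≤ q * (q' - q) := by
  have e : q * (q' - q) = (n : ℝ)⁻¹ * ∑ i, planarWeight a b η p q i * (q * b i) := by
    rw [hq', Finset.mul_sum, add_sub_cancel_left, Finset.mul_sum, Finset.mul_sum]
    exact Finset.sum_congr rfl fun i _ => by ring
  have e2 : -(|q| * opposingWeight a b η p q)
      = (n : ℝ)⁻¹ * ∑ i ∈ opposing b q, -(|q| * planarWeight a b η p q i) := by
    unfold opposingWeight
    rw [Finset.sum_neg_distrib, ← Finset.mul_sum]; ring
  rw [e, e2]
  refine mul_le_mul_of_nonneg_left ?_ (by positivity)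
  rw [← Finset.sum_add_sum_compl (opposing b q) fun i => planarWeight a b η p q i * (q * b i)]
  have h1 : 0 ≤ ∑ i ∈ (opposing b q)ᶜ, planarWeight a b η p q i * (q * b i) := by
    refine Finset.sum_nonneg fun i hi => ?_
    have h : 0 ≤ q * b i := by simpa [opposing] using hi
    exact mul_nonneg (planarWeight_pos a b η p q i).le h
  have h2 : ∑ i ∈ opposing b q, -(|q| * planarWeight a b η p q i)
      ≤ ∑ i ∈ opposing b q, planarWeight a b η p q i * (q * b i) := by
    refine Finset.sum_le_sum fun i _ => ?_
    have h : -|q| ≤ q * b i := by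
      have h3 := neg_abs_le (q * b i)
      rw [abs_mul] at h3
      nlinarith [S.abs_le_one i, abs_nonneg q]
    nlinarith [planarWeight_pos a b η p q i]
  linarith

theorem drift_nonpos (S : SeparatedPlanarData n a b γ η) (hp : γ / 2 ≤ p) (hq : |q| ≤ 1)
    (hF : 1 / (8 * η) < planarLoss a b η p q)
    (hq' : q' = q + (n : ℝ)⁻¹ * ∑ i, planarWeight a b η p q i * b i) :
    q * (q' - q) ≤ 0 := by
  have hη := S.one_le
  have hγ := S.margin_pos
  have hn' : (0 : ℝ) < n := by exact_mod_cast S.n_pos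
  obtain ⟨j, hj, hi⟩ := S.exists_opposing_margin_le hp hF
  have h1 := S.drift_le hp hq hq' hj
  have h2 := S.mul_margin_le_neg hp hi
  have h3 : 1 / (10 * η) ≤ planarWeight a b η p q j := by
    unfold planarWeight
    rw [← one_div]
    refine one_div_le_one_div_of_le (by positivity) ?_
    rw [Real.exp_neg, ← one_div] at hi
    have := (one_div_lt_one_div (by positivity) (Real.exp_pos _)).1 hi
    linarith
  have h4 : 1 / η ≤ (n : ℝ)⁻¹ := by
    rw [← one_div]
    exact one_div_le_one_div_of_le hn' S.n_le
  have h5 : 7 / 16 * γ ^ 2 ≤ -(q * b j) := by nlinarith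
  have h6 : 1 / η * (1 / (10 * η) * (7 / 16 * γ ^ 2))
      ≤ (n : ℝ)⁻¹ * (planarWeight a b η p q j * -(q * b j)) := by
    have := (planarWeight_pos a b η p q j).le
    gcongr
  have h7 : γ ^ 2 / (72 * η ^ 2) ≤ 1 / η * (1 / (10 * η) * (7 / 16 * γ ^ 2)) := by
    have : 1 / η * (1 / (10 * η) * (7 / 16 * γ ^ 2)) = γ ^ 2 / (160 / 7 * η ^ 2) := by
      field_simp; norm_num
    rw [this]
    gcongr
    norm_num
  nlinarith

theorem abs_next_sub_le (S : SeparatedPlanarData n a b γ η)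
    (hq' : q' = q + (n : ℝ)⁻¹ * ∑ i, planarWeight a b η p q i * b i) : |q' - q| ≤ 1 := by
  rw [hq', add_sub_cancel_left, abs_le]
  have key : ∀ i, |planarWeight a b η p q i * b i| ≤ 1 := fun i => by
    rw [abs_mul, abs_of_pos (planarWeight_pos a b η p q i)]
    exact mul_le_one₀ (planarWeight_le_one a b η p q i) (abs_nonneg _) (S.abs_le_one i)
  constructor
  · have := average_le_of_le S.n_pos univ (fun i => -(planarWeight a b η p q i * b i))
      zero_le_one fun i _ => (neg_le_abs _).trans (key i)
    rw [Finset.sum_neg_distrib] at this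
    linarith
  · exact average_le_of_le S.n_pos univ _ zero_le_one fun i _ => (le_abs_self _).trans (key i)

theorem abs_next_le_one (S : SeparatedPlanarData n a b γ η) (hp : γ / 2 ≤ p) (hq : |q| ≤ 1)
    (hF : 1 / (8 * η) < planarLoss a b η p q)
    (hq' : q' = q + (n : ℝ)⁻¹ * ∑ i, planarWeight a b η p q i * b i) : |q'| ≤ 1 := by
  have h1 := S.drift_nonpos hp hq hF hq'
  have h2 := abs_le.1 (S.abs_next_sub_le hq')
  have h3 := S.abs_ge hp hF
  have h4 : 0 < |q| := lt_of_lt_of_le (by nlinarith [S.margin_pos]) h3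
  rw [abs_le] at hq ⊢
  rcases lt_or_gt_of_ne (abs_pos.1 h4) with h | h
  · have : 0 ≤ q' - q := by by_contra! hc; nlinarith
    constructor <;> linarith
  · have : q' - q ≤ 0 := by by_contra! hc; nlinarith
    constructor <;> linarith

theorem next_ge (S : SeparatedPlanarData n a b γ η)
    (hp' : p' = p + (n : ℝ)⁻¹ * ∑ i, planarWeight a b η p q i * a i) :
    p + γ * ((n : ℝ)⁻¹ * ∑ i, planarWeight a b η p q i) ≤ p' := by
  rw [hp', mul_left_comm, Finset.mul_sum]
  gcongr _ + _ * ∑ i, ?_ with i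
  rw [mul_comm γ]
  exact mul_le_mul_of_nonneg_left (S.margin_le i) (planarWeight_pos a b η p q i).le

theorem average_weight_nonneg : 0 ≤ (n : ℝ)⁻¹ * ∑ i, planarWeight a b η p q i :=
  mul_nonneg (by positivity) (Finset.sum_nonneg fun i _ => (planarWeight_pos a b η p q i).le)

theorem opposingWeight_ge_of_flip (S : SeparatedPlanarData n a b γ η) (hp : γ / 2 ≤ p)
    (hF : 1 / (8 * η) < planarLoss a b η p q)
    (hp' : p ≤ p') (hF' : 1 / (8 * η) < planarLoss a b η p' q')
    (hq' : q' = q + (n : ℝ)⁻¹ * ∑ i, planarWeight a b η p q i * b i) (hflip : q * q' ≤ 0) :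
    7 / 4 * (γ * p) ≤ opposingWeight a b η p q := by
  have h1 := S.abs_ge hp hF
  have h2 := S.abs_ge (hp.trans hp') hF'
  have h3 := S.drift_ge hq'
  have hγ := S.margin_pos
  have h4 : 0 < |q| := lt_of_lt_of_le (by nlinarith) h1
  have h5 : q * q' = -(|q| * |q'|) := by rw [← abs_mul, abs_of_nonpos hflip, neg_neg]
  have h6 : |q| + |q'| ≤ opposingWeight a b η p q := by
    have : |q| * (|q| + |q'|) ≤ |q| * opposingWeight a b η p q := by
      nlinarith [abs_mul_abs_self q]
    exact le_of_mul_le_mul_left this h4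
  nlinarith

theorem next_sq_le (hd : q * (q' - q) ≤ 0) (hs : 0 < q * q') : q' ^ 2 ≤ q ^ 2 + q * (q' - q) := by
  have hq : q ≠ 0 := by rintro rfl; simp at hs
  have h1 : 0 < q ^ 2 := by positivity
  have h3 : q ^ 2 * (q' * (q' - q)) = (q * q') * (q * (q' - q)) := by ring
  have : q' * (q' - q) ≤ 0 := by
    by_contra! hc
    nlinarith [mul_pos h1 hc, mul_nonneg hs.le (neg_nonneg.2 hd)]
  nlinarith

theorem opposing_eq (hs : 0 < q * q') : opposing b q' = opposing b q := by
  have key : ∀ u v c : ℝ, 0 < u * v → u * c < 0 → v * c < 0 := fun u v c huv huc => by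
    by_contra! hvc
    have hc : c ≠ 0 := by rintro rfl; simp at huc
    have h1 : 0 < u * v * c ^ 2 := by positivity
    nlinarith [mul_nonneg (neg_nonneg.2 huc.le) hvc]
  ext i
  simp only [opposing, mem_filter, mem_univ, true_and]
  exact ⟨key _ _ _ (by rwa [mul_comm]), key _ _ _ hs⟩

theorem margin_next_ge (S : SeparatedPlanarData n a b γ η) (hp' : p ≤ p')
    (hd : q * (q' - q) ≤ 0) {i : Fin n} (hi : i ∈ opposing b q) :
    planarMargin a b η p q i + η * (γ * (p' - p)) ≤ planarMargin a b η p' q' i := by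
  have hη := S.one_le
  have hi' : q * b i < 0 := by simpa [opposing] using hi
  have h1 : 0 ≤ (q' - q) * b i := by
    by_contra! hc
    have hq : 0 < q ^ 2 := by
      have : q ≠ 0 := by rintro rfl; simp at hi'
      positivity
    have hb : 0 < b i ^ 2 := by
      have : b i ≠ 0 := by intro h; simp [h] at hi'
      positivity
    nlinarith [mul_pos_of_neg_of_neg hi' hc]
  have h2 : γ * (p' - p) ≤ a i * (p' - p) :=
    mul_le_mul_of_nonneg_right (S.margin_le i) (by linarith)
  unfold planarMargin
  nlinarith

theorem opposingWeight_next_le (S : SeparatedPlanarData n a b γ η) (hp' : p ≤ p')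
    (hd : q * (q' - q) ≤ 0) (hs : 0 < q * q') :
    opposingWeight a b η p' q' ≤ opposingWeight a b η p q := by
  have hη := S.one_le
  unfold opposingWeight
  rw [opposing_eq hs]
  refine mul_le_mul_of_nonneg_left (Finset.sum_le_sum fun i hi => ?_) (by positivity)
  unfold planarWeight
  have h1 := S.margin_next_ge hp' hd hi
  have h2 : 0 ≤ η * (γ * (p' - p)) :=
    mul_nonneg (by linarith) (mul_nonneg S.margin_pos.le (by linarith))
  exact inv_anti₀ (by positivity) (by gcongr; linarith)

theorem opposingExp_next_le (S : SeparatedPlanarData n a b γ η) (hp' : p ≤ p')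
    (hd : q * (q' - q) ≤ 0) (hs : 0 < q * q') :
    opposingExp a b η p' q' ≤ Real.exp (-(η * (γ * (p' - p)))) * opposingExp a b η p q := by
  unfold opposingExp
  rw [opposing_eq hs, mul_left_comm, Finset.mul_sum _ _ (Real.exp _)]
  refine mul_le_mul_of_nonneg_left (Finset.sum_le_sum fun i hi => ?_) (by positivity)
  rw [← Real.exp_add]
  have h1 := S.margin_next_ge hp' hd hi
  exact Real.exp_le_exp.2 (by linarith)

theorem average_weight_ge (hn : 0 < n) {i : Fin n} (hi : planarMargin a b η p q i ≤ 0) :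
    1 / (2 * n) ≤ (n : ℝ)⁻¹ * ∑ i, planarWeight a b η p q i := by
  have h1 : 1 / 2 ≤ planarWeight a b η p q i := by
    unfold planarWeight
    rw [← one_div]
    have := Real.exp_le_one_iff.2 hi
    exact one_div_le_one_div_of_le (by positivity) (by linarith)
  have h2 := Finset.single_le_sum (f := planarWeight a b η p q)
    (fun j _ => (planarWeight_pos a b η p q j).le) (Finset.mem_univ i)
  have hn' : (0 : ℝ) < n := by exact_mod_cast hn
  have h3 : (1 : ℝ) / (2 * n) = (n : ℝ)⁻¹ * (1 / 2) := by field_simp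
  rw [h3]
  gcongr
  linarith

theorem average_weight_ge_opposingExp
    (h : ∀ i ∈ opposing b q, 0 < planarMargin a b η p q i) :
    opposingExp a b η p q / 2 ≤ (n : ℝ)⁻¹ * ∑ i, planarWeight a b η p q i := by
  refine le_trans ?_ (opposingWeight_le_average a b η p q)
  unfold opposingExp opposingWeight
  rw [mul_div_assoc, Finset.sum_div]
  refine mul_le_mul_of_nonneg_left (Finset.sum_le_sum fun i hi => ?_) (by positivity)
  unfold planarWeight
  have h1 := Real.one_lt_exp_iff.2 (h i hi)
  rw [Real.exp_neg, div_eq_mul_inv, ← mul_inv]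
  exact inv_anti₀ (by positivity) (by linarith)

/-- A misclassified opposing point forces a definite decrease of `q ^ 2`. -/
theorem next_sq_le_of_margin_nonpos (S : SeparatedPlanarData n a b γ η) (hp : γ / 2 ≤ p)
    (hq : |q| ≤ 1) (hF : 1 / (8 * η) < planarLoss a b η p q)
    (hq' : q' = q + (n : ℝ)⁻¹ * ∑ i, planarWeight a b η p q i * b i) (hs : 0 < q * q')
    {i : Fin n} (hi : i ∈ opposing b q) (hm : planarMargin a b η p q i ≤ 0) :
    q' ^ 2 ≤ q ^ 2 - p * γ / (2 * n) + γ ^ 2 / (72 * n ^ 2) := by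
  have hη := S.one_le
  have hγ := S.margin_pos
  have hn' : (0 : ℝ) < n := by exact_mod_cast S.n_pos
  have hi' : q * b i < 0 := by simpa [opposing] using hi
  have h1 := next_sq_le (S.drift_nonpos hp hq hF hq') hs
  have h2 := S.drift_le hp hq hq' hi'
  have h3 : 1 / 2 ≤ planarWeight a b η p q i := by
    unfold planarWeight
    rw [← one_div]
    have := Real.exp_le_one_iff.2 hm
    exact one_div_le_one_div_of_le (by positivity) (by linarith)
  have h4 : p * γ ≤ -(q * b i) := by
    have h5 : p * a i + q * b i ≤ 0 := by
      unfold planarMargin at hm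
      by_contra! hc
      nlinarith [mul_pos (by linarith : 0 < η) hc]
    have h6 : p * γ ≤ p * a i := mul_le_mul_of_nonneg_left (S.margin_le i) (by linarith)
    linarith
  have h7 : (n : ℝ)⁻¹ * (1 / 2 * (p * γ)) ≤ (n : ℝ)⁻¹ * (planarWeight a b η p q i * -(q * b i)) := by
    have : 0 ≤ p * γ := mul_nonneg (by linarith) hγ.le
    gcongr
  have h8 : γ ^ 2 / (72 * η ^ 2) ≤ γ ^ 2 / (72 * (n : ℝ) ^ 2) := by
    gcongr
    exact S.n_le
  have h9 : p * γ / (2 * n) = (n : ℝ)⁻¹ * (1 / 2 * (p * γ)) := by field_simp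
  rw [h9]
  nlinarith

end SeparatedPlanarData

/-- Gradient descent in orthonormal coordinates, rescaled by the step size, up to time `N`
before which the loss has not dropped below `1 / (8 η)`. -/
structure UnfinishedRun {n : ℕ} (a b : Fin n → ℝ) (γ η : ℝ) (p q : ℕ → ℝ) (N : ℕ) : Prop where
  data : SeparatedPlanarData n a b γ η
  p_succ : ∀ t, p (t + 1) = p t + (n : ℝ)⁻¹ * ∑ i, planarWeight a b η (p t) (q t) i * a i
  q_succ : ∀ t, q (t + 1) = q t + (n : ℝ)⁻¹ * ∑ i, planarWeight a b η (p t) (q t) i * b i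
  p_one : γ / 2 ≤ p 1
  q_one : |q 1| ≤ 1
  unfinished : ∀ t, 1 ≤ t → t ≤ N → 1 / (8 * η) < planarLoss a b η (p t) (q t)

namespace UnfinishedRun

variable {n N : ℕ} {a b : Fin n → ℝ} {γ η : ℝ} {p q : ℕ → ℝ}

theorem p_step (R : UnfinishedRun a b γ η p q N) (t : ℕ) :
    p t + γ * ((n : ℝ)⁻¹ * ∑ i, planarWeight a b η (p t) (q t) i) ≤ p (t + 1) :=
  R.data.next_ge (R.p_succ t)

theorem p_mono (R : UnfinishedRun a b γ η p q N) : Monotone p :=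
  monotone_nat_of_le_succ fun t => by
    have := R.p_step t
    have := mul_nonneg R.data.margin_pos.le
      (SeparatedPlanarData.average_weight_nonneg (a := a) (b := b) (η := η) (p := p t) (q := q t))
    linarith

theorem p_ge (R : UnfinishedRun a b γ η p q N) {t : ℕ} (ht : 1 ≤ t) : γ / 2 ≤ p t :=
  R.p_one.trans (R.p_mono ht)

theorem abs_q_le_one (R : UnfinishedRun a b γ η p q N) {t : ℕ} (ht : 1 ≤ t) (htN : t ≤ N) :
    |q t| ≤ 1 := by
  induction t, ht using Nat.le_induction with
  | base => exact R.q_one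
  | succ t ht ih =>
    exact R.data.abs_next_le_one (R.p_ge ht) (ih (by omega)) (R.unfinished t ht (by omega))
      (R.q_succ t)

theorem drift_nonpos (R : UnfinishedRun a b γ η p q N) {t : ℕ} (ht : 1 ≤ t) (htN : t ≤ N) :
    q t * (q (t + 1) - q t) ≤ 0 :=
  R.data.drift_nonpos (R.p_ge ht) (R.abs_q_le_one ht htN) (R.unfinished t ht htN) (R.q_succ t)

/-- While the opposing weight stays proportional to `p`, the coordinate `p` grows geometrically;
as the weight is at most one, this lasts only logarithmically long. -/
theorem heavy_time_le (R : UnfinishedRun a b γ η p q N) {m : ℕ}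
    (h : ∀ t, 1 ≤ t → t ≤ m + 1 →
      7 / 4 * (γ * p t) ≤ opposingWeight a b η (p t) (q t)) :
    (m : ℝ) ≤ 2 / γ ^ 2 * Real.log (2 / γ ^ 2) := by
  have hγ := R.data.margin_pos
  have hγ1 := R.data.margin_lt_one
  have key : ∀ k, k ≤ m → γ / 2 * (1 + 7 / 4 * γ ^ 2) ^ k ≤ p (k + 1) := by
    intro k hk
    induction k with
    | zero => simpa using R.p_one
    | succ k ih =>
      have h1 := ih (by omega)
      have h2 := h (k + 1) (by omega) (by omega)
      have h3 := R.p_step (k + 1)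
      have h4 := opposingWeight_le_average a b η (p (k + 1)) (q (k + 1))
      have h5 : p (k + 1) * (1 + 7 / 4 * γ ^ 2) ≤ p (k + 1 + 1) := by
        nlinarith [mul_le_mul_of_nonneg_left (h2.trans h4) hγ.le]
      rw [pow_succ, ← mul_assoc]
      exact (mul_le_mul_of_nonneg_right h1 (by positivity)).trans h5
  have h1 := key m le_rfl
  have h2 := (h (m + 1) (by omega) le_rfl).trans
    (opposingWeight_le_one R.data.n_pos a b η (p (m + 1)) (q (m + 1)))
  have h3 : (1 + 7 / 4 * γ ^ 2) ^ m ≤ 2 / γ ^ 2 := by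
    rw [le_div_iff₀ (by positivity)]
    nlinarith [mul_le_mul_of_nonneg_left h1 hγ.le,
      (by positivity : 0 < (1 + 7 / 4 * γ ^ 2) ^ m * γ ^ 2)]
  have h4 := Real.log_le_log (by positivity) h3
  rw [Real.log_pow] at h4
  have h5 : γ ^ 2 / 2 ≤ Real.log (1 + 7 / 4 * γ ^ 2) := by
    have h6 := Real.one_sub_inv_le_log_of_pos (by positivity : 0 < 1 + 7 / 4 * γ ^ 2)
    refine le_trans ?_ h6
    have h7 : 1 - (1 + 7 / 4 * γ ^ 2)⁻¹ = 7 / 4 * γ ^ 2 / (1 + 7 / 4 * γ ^ 2) := by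
      field_simp; ring
    rw [h7, le_div_iff₀ (by positivity)]
    have : γ ^ 2 ≤ 1 := by nlinarith
    nlinarith [sq_nonneg γ]
  have h6 : (m : ℝ) * (γ ^ 2 / 2) ≤ Real.log (2 / γ ^ 2) :=
    (mul_le_mul_of_nonneg_left h5 (Nat.cast_nonneg m)).trans h4
  rw [div_mul_eq_mul_div, le_div_iff₀ (by positivity)]
  linarith

/-- Once the opposing weight is small compared with `p`, the sign of `q` no longer changes. -/
theorem sign_stable (R : UnfinishedRun a b γ η p q N) {j : ℕ} (hj : 1 ≤ j)
    (h : j < N → opposingWeight a b η (p j) (q j) < 7 / 4 * (γ * p j)) {t : ℕ} (ht : j ≤ t)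
    (htN : t < N) : 0 < q t * q (t + 1) := by
  have step : ∀ t, 1 ≤ t → t < N → opposingWeight a b η (p t) (q t) < 7 / 4 * (γ * p t) →
      0 < q t * q (t + 1) := fun t h1 h2 h3 => by
    by_contra! hc
    exact absurd h3 (not_lt.2 (R.data.opposingWeight_ge_of_flip (R.p_ge h1)
      (R.unfinished t h1 h2.le) (R.p_mono t.le_succ) (R.unfinished (t + 1) (by omega) h2)
      (R.q_succ t) hc))
  have light : opposingWeight a b η (p t) (q t) < 7 / 4 * (γ * p t) := by
    induction t, ht using Nat.le_induction with
    | base => exact h htN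
    | succ t ht ih =>
      have h1 := ih (by omega)
      have h2 := step t (by omega) (by omega) h1
      have h3 := R.data.opposingWeight_next_le (R.p_mono t.le_succ)
        (R.drift_nonpos (by omega) (by omega)) h2
      have h4 := mul_le_mul_of_nonneg_left (R.p_mono t.le_succ) R.data.margin_pos.le
      simp only [Nat.succ_eq_add_one] at h4 h3
      linarith
  exact step t (by omega) htN light

theorem misclassified_time_le (R : UnfinishedRun a b γ η p q N) {j m : ℕ} (hj : 1 ≤ j)
    (hm : j + m ≤ N) (hs : ∀ t, j ≤ t → t < N → 0 < q t * q (t + 1))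
    (h : ∀ t, j ≤ t → t < j + m →
      ∃ i ∈ opposing b (q t), planarMargin a b η (p t) (q t) i ≤ 0) :
    (m : ℝ) ≤ 4 * n / γ := by
  have hγ := R.data.margin_pos
  have hn' : (0 : ℝ) < n := by exact_mod_cast R.data.n_pos
  have hn1 : (1 : ℝ) ≤ n := by exact_mod_cast R.data.n_pos
  have key : ∀ k, k ≤ m → γ / 2 + γ * k / (2 * n) ≤ p (j + k) ∧
      q (j + k) ^ 2 + γ ^ 2 * k ^ 2 / (8 * n ^ 2) ≤ 1 := by
    intro k hk
    induction k with
    | zero =>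
      have := R.p_ge hj
      have h1 := R.abs_q_le_one hj (by omega)
      have h2 : q j ^ 2 ≤ 1 := (sq_le_one_iff_abs_le_one _).2 h1
      simp; constructor <;> linarith
    | succ k ih =>
      obtain ⟨h1, h2⟩ := ih (by omega)
      obtain ⟨i, hi, hmi⟩ := h (j + k) (by omega) (by omega)
      have h3 := R.p_step (j + k)
      have h4 := mul_le_mul_of_nonneg_left
        (SeparatedPlanarData.average_weight_ge R.data.n_pos hmi) hγ.le
      have h5 := R.data.next_sq_le_of_margin_nonpos (R.p_ge (by omega))
        (R.abs_q_le_one (by omega) (by omega)) (R.unfinished (j + k) (by omega) (by omega))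
        (R.q_succ (j + k)) (hs (j + k) (by omega) (by omega)) hi hmi
      rw [← add_assoc]
      push_cast
      constructor
      · have : γ * ((k : ℝ) + 1) / (2 * n) = γ * k / (2 * n) + γ * (1 / (2 * n)) := by ring
        linarith
      · have h6 : (γ / 2 + γ * k / (2 * n)) * γ / (2 * n) ≤ p (j + k) * γ / (2 * n) := by gcongr
        have h7 : γ ^ 2 * ((k : ℝ) + 1) ^ 2 / (8 * n ^ 2) + γ ^ 2 / (72 * n ^ 2) ≤
            γ ^ 2 * k ^ 2 / (8 * n ^ 2) + (γ / 2 + γ * k / (2 * n)) * γ / (2 * n) := by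
          rw [← sub_nonneg]
          have : γ ^ 2 * (k : ℝ) ^ 2 / (8 * n ^ 2) + (γ / 2 + γ * k / (2 * n)) * γ / (2 * n)
              - (γ ^ 2 * ((k : ℝ) + 1) ^ 2 / (8 * n ^ 2) + γ ^ 2 / (72 * n ^ 2))
              = γ ^ 2 * (18 * n - 10) / (72 * n ^ 2) := by
            field_simp; ring
          rw [this]
          have : (0 : ℝ) ≤ 18 * n - 10 := by linarith
          positivity
        linarith
  have h1 := (key m le_rfl).2
  have h2 : γ ^ 2 * (m : ℝ) ^ 2 / (8 * n ^ 2) ≤ 1 := by nlinarith [sq_nonneg (q (j + m))]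
  rw [div_le_one (by positivity)] at h2
  rw [le_div_iff₀ hγ]
  refine le_of_sq_le_sq ?_ (by positivity)
  nlinarith

theorem classified_time_le (R : UnfinishedRun a b γ η p q N) {r m : ℕ} (hr : 1 ≤ r)
    (hm : r + m = N) (hs : ∀ t, r ≤ t → t < N → 0 < q t * q (t + 1))
    (h : ∀ i ∈ opposing b (q r), 0 < planarMargin a b η (p r) (q r) i) :
    (m : ℝ) ≤ 18 / γ ^ 2 := by
  have hγ := R.data.margin_pos
  have hη := R.data.one_le
  have key : ∀ k, k ≤ m →
      (∀ i ∈ opposing b (q (r + k)), 0 < planarMargin a b η (p (r + k)) (q (r + k)) i) ∧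
      k * (η * γ ^ 2 / 2) * opposingExp a b η (p (r + k)) (q (r + k)) ≤ 1 := by
    intro k hk
    induction k with
    | zero => exact ⟨h, by simp⟩
    | succ k ih =>
      obtain ⟨h1, h2⟩ := ih (by omega)
      have hd := R.drift_nonpos (t := r + k) (by omega) (by omega)
      have hs' := hs (r + k) (by omega) (by omega)
      have hp := R.p_mono (r + k).le_succ
      rw [← add_assoc]
      refine ⟨fun i hi => ?_, ?_⟩
      · rw [SeparatedPlanarData.opposing_eq hs'] at hi
        have h3 := R.data.margin_next_ge hp hd hi
        have h4 := mul_nonneg (by linarith : 0 ≤ η) (mul_nonneg hγ.le (sub_nonneg.2 hp))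
        have h5 := h1 i hi
        simp only [Nat.succ_eq_add_one] at h3 h4
        linarith
      · have h3 := R.data.opposingExp_next_le hp hd hs'
        simp only [Nat.succ_eq_add_one] at h3
        set E := opposingExp a b η (p (r + k)) (q (r + k))
        set E' := opposingExp a b η (p (r + k + 1)) (q (r + k + 1))
        have hE : 0 < E := lt_trans (by positivity)
          (R.data.opposingExp_gt (R.p_ge (by omega)) (R.unfinished (r + k) (by omega) (by omega)))
        have hE' : 0 < E' := lt_trans (by positivity)
          (R.data.opposingExp_gt (R.p_ge (by omega))
            (R.unfinished (r + k + 1) (by omega) (by omega)))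
        have h4 : γ * (E / 2) ≤ p (r + k + 1) - p (r + k) := by
          have h5 := R.p_step (r + k)
          have h6 := mul_le_mul_of_nonneg_left
            (SeparatedPlanarData.average_weight_ge_opposingExp h1) hγ.le
          linarith
        set d := η * (γ * (p (r + k + 1) - p (r + k)))
        have h5 : η * γ ^ 2 / 2 * E ≤ d := by
          have := mul_le_mul_of_nonneg_left (mul_le_mul_of_nonneg_left h4 hγ.le)
            (by linarith : 0 ≤ η)
          calc η * γ ^ 2 / 2 * E = η * (γ * (γ * (E / 2))) := by ring
            _ ≤ d := this
        have h6 : (1 + d) * E' ≤ E := by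
          have h7 : (1 + d) * E' ≤ Real.exp d * E' := by
            gcongr
            linarith [Real.add_one_le_exp d]
          have h8 : Real.exp d * E' ≤ Real.exp d * (Real.exp (-d) * E) := by gcongr
          rw [← mul_assoc, ← Real.exp_add, add_neg_cancel, Real.exp_zero, one_mul] at h8
          linarith
        set c := η * γ ^ 2 / 2
        have hc : 0 < c := by positivity
        have h7 : (1 + c * E) * E' ≤ E :=
          le_trans (mul_le_mul_of_nonneg_right (by linarith) hE'.le) h6
        push_cast
        have h8 : ((k : ℝ) + 1) * c * E ≤ 1 + c * E := by linarith
        have h9 : E * (((k : ℝ) + 1) * c * E') ≤ E * 1 := by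
          nlinarith [mul_le_mul_of_nonneg_right h8 hE'.le]
        exact le_of_mul_le_mul_left h9 hE
  obtain ⟨-, h1⟩ := key m le_rfl
  have h2 := R.data.opposingExp_gt (R.p_ge (t := r + m) (by omega))
    (R.unfinished (r + m) (by omega) (by omega))
  have h3 : m * (η * γ ^ 2 / 2) * (1 / (9 * η)) ≤ 1 :=
    (mul_le_mul_of_nonneg_left h2.le (by positivity)).trans h1
  have h4 : m * (η * γ ^ 2 / 2) * (1 / (9 * η)) = m * γ ^ 2 / 18 := by
    field_simp; ring
  rw [le_div_iff₀ (by positivity)]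
  linarith

theorem length_le (R : UnfinishedRun a b γ η p q N) (hN : 1 ≤ N) :
    (N : ℝ) ≤ 2 + 2 / γ ^ 2 * Real.log (2 / γ ^ 2) + 4 * n / γ + 18 / γ ^ 2 := by
  classical
  have hγ := R.data.margin_pos
  have hγ1 := R.data.margin_lt_one
  have ex1 : ∃ t, 1 ≤ t ∧
      (t = N ∨ opposingWeight a b η (p t) (q t) < 7 / 4 * (γ * p t)) := ⟨N, hN, Or.inl rfl⟩
  obtain ⟨hj1, hj2⟩ := Nat.find_spec ex1
  have hj3 : Nat.find ex1 ≤ N := Nat.find_min' ex1 ⟨hN, Or.inl rfl⟩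
  have hj4 := fun t (ht : t < Nat.find ex1) => Nat.find_min ex1 ht
  set j := Nat.find ex1
  have hjle : (j : ℝ) ≤ 2 + 2 / γ ^ 2 * Real.log (2 / γ ^ 2) := by
    have hlog : 0 ≤ 2 / γ ^ 2 * Real.log (2 / γ ^ 2) := by
      refine mul_nonneg (by positivity) (Real.log_nonneg ?_)
      rw [le_div_iff₀ (by positivity)]
      nlinarith
    by_cases hj : j ≤ 1
    · have : (j : ℝ) ≤ 1 := by exact_mod_cast hj
      linarith
    · obtain ⟨m, hm⟩ : ∃ m, j = m + 2 := ⟨j - 2, by omega⟩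
      have := R.heavy_time_le (m := m) fun t h1 h2 => by
        have h3 := hj4 t (by omega)
        push Not at h3
        exact (h3 h1).2
      rw [hm]
      push_cast
      linarith
  have hs : ∀ t, j ≤ t → t < N → 0 < q t * q (t + 1) := fun t h1 h2 =>
    R.sign_stable hj1 (fun h => hj2.resolve_left h.ne) h1 h2
  have ex2 : ∃ m, j + m = N ∨
      ¬ ∃ i ∈ opposing b (q (j + m)), planarMargin a b η (p (j + m)) (q (j + m)) i ≤ 0 :=
    ⟨N - j, Or.inl (by omega)⟩
  have hm1 := Nat.find_spec ex2
  have hm2 : Nat.find ex2 ≤ N - j := Nat.find_min' ex2 (Or.inl (by omega))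
  have hm3 := fun k (hk : k < Nat.find ex2) => Nat.find_min ex2 hk
  set m := Nat.find ex2
  have hmle := R.misclassified_time_le (m := m) hj1 (by omega) hs fun t h1 h2 => by
    have h3 := hm3 (t - j) (by omega)
    push Not at h3
    rw [Nat.add_sub_cancel' h1] at h3
    exact h3.2
  have hk : ((N - (j + m) : ℕ) : ℝ) ≤ 18 / γ ^ 2 := by
    rcases hm1 with h | h
    · rw [h, Nat.sub_self]
      simp; positivity
    · push Not at h
      exact R.classified_time_le (r := j + m) (by omega) (by omega)
        (fun t h1 h2 => hs t (by omega) h2) h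
  have : (N : ℝ) = j + m + (N - (j + m) : ℕ) := by
    rw [← Nat.cast_add, ← Nat.cast_add]
    congr 1
    omega
  linarith

end UnfinishedRun

theorem log_one_add_exp_neg_add_le (z : ℝ) {d : ℝ} (hd : |d| ≤ 1) :
    Real.log (1 + Real.exp (-(z + d))) ≤
      Real.log (1 + Real.exp (-z)) - (Real.exp z + 1)⁻¹ * d + (Real.exp z + 1)⁻¹ * d ^ 2 := by
  set s := (Real.exp z + 1)⁻¹ with hs
  have hs0 : 0 < s := by positivity
  have h1 : Real.exp (-d) ≤ 1 - d + d ^ 2 := by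
    have := abs_le.1 (Real.abs_exp_sub_one_sub_id_le (x := -d) (by rwa [abs_neg]))
    nlinarith [this.2]
  have h2 : 1 + Real.exp (-(z + d)) = (1 + Real.exp (-z)) * (1 + s * (Real.exp (-d) - 1)) := by
    rw [neg_add, Real.exp_add, hs, Real.exp_neg z]
    have := Real.exp_pos z
    field_simp
    ring
  have h3 : 1 + s * (Real.exp (-d) - 1) ≤ Real.exp (s * (-d + d ^ 2)) := by
    have h4 := Real.add_one_le_exp (s * (-d + d ^ 2))
    have h5 : s * (Real.exp (-d) - 1) ≤ s * (-d + d ^ 2) :=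
      mul_le_mul_of_nonneg_left (by linarith) hs0.le
    linarith
  have h6 : Real.log (1 + Real.exp (-(z + d))) ≤
      Real.log ((1 + Real.exp (-z)) * Real.exp (s * (-d + d ^ 2))) := by
    refine Real.log_le_log (by positivity) ?_
    rw [h2]
    gcongr
  rw [Real.log_mul (by positivity) (by positivity), Real.log_exp] at h6
  linarith

theorem inv_exp_add_one_le_log (z : ℝ) :
    (Real.exp z + 1)⁻¹ ≤ Real.log (1 + Real.exp (-z)) := by
  have h := Real.one_sub_inv_le_log_of_pos (by positivity : 0 < 1 + Real.exp (-z))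
  refine le_trans (le_of_eq ?_) h
  rw [Real.exp_neg]
  have := Real.exp_pos z
  field_simp
  ring

theorem log_div_two_le_inv_exp_add_one {z : ℝ} (h : Real.log (1 + Real.exp (-z)) ≤ 1) :
    Real.log (1 + Real.exp (-z)) / 2 ≤ (Real.exp z + 1)⁻¹ := by
  set l := Real.log (1 + Real.exp (-z)) with hl
  have h0 : 0 ≤ l := Real.log_nonneg (by linarith [Real.exp_pos (-z)])
  have h1 : Real.exp l = 1 + Real.exp (-z) := Real.exp_log (by positivity)
  have h2 : (Real.exp z + 1)⁻¹ = 1 - (Real.exp l)⁻¹ := by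
    rw [h1, Real.exp_neg]
    have := Real.exp_pos z
    field_simp
    ring
  rw [h2]
  have h3 : (Real.exp l)⁻¹ ≤ 1 - l / 2 := by
    rw [inv_le_comm₀ (Real.exp_pos _) (by linarith)]
    refine le_trans ?_ (Real.add_one_le_exp l)
    rw [inv_le_iff_one_le_mul₀ (by linarith)]
    nlinarith
  linarith

theorem logisticLoss_nonneg (n : ℕ) (x : Fin n → EuclideanSpace ℝ (Fin 2))
    (w : EuclideanSpace ℝ (Fin 2)) : 0 ≤ logisticLoss n x w :=
  mul_nonneg (by positivity) (Finset.sum_nonneg fun i _ =>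
    Real.log_nonneg (by linarith [Real.exp_pos (-⟪w, x i⟫_ℝ)]))

/-- Below the threshold `1 / (8 η)`, each gradient step decreases the loss quadratically. -/
theorem logisticLoss_step_le {n : ℕ} (hn : 0 < n) {x : Fin n → EuclideanSpace ℝ (Fin 2)}
    (hx : ∀ i, ‖x i‖ ≤ 1) {γ η : ℝ} (hγ : 0 < γ) {e : EuclideanSpace ℝ (Fin 2)} (he : ‖e‖ = 1)
    (hmargin : ∀ i, γ ≤ ⟪e, x i⟫_ℝ) (hnη : (n : ℝ) ≤ η) (w : EuclideanSpace ℝ (Fin 2))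
    (hF : logisticLoss n x w ≤ 1 / (8 * η)) :
    logisticLoss n x (w + (η / n) • ∑ i, (Real.exp ⟪w, x i⟫_ℝ + 1)⁻¹ • x i) ≤
      logisticLoss n x w - η * γ ^ 2 / 8 * logisticLoss n x w ^ 2 := by
  have hn' : (0 : ℝ) < n := by exact_mod_cast hn
  have hη : 0 < η := hn'.trans_le hnη
  have hF0 := logisticLoss_nonneg n x w
  set s : Fin n → ℝ := fun i => (Real.exp ⟪w, x i⟫_ℝ + 1)⁻¹ with hs
  have hs0 : ∀ i, 0 < s i := fun i => by simp only [hs]; positivity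
  set g : EuclideanSpace ℝ (Fin 2) := (n : ℝ)⁻¹ • ∑ i, s i • x i with hg
  set G : ℝ := (n : ℝ)⁻¹ * ∑ i, s i with hG
  have hstep : (η / n) • ∑ i, s i • x i = η • g := by
    rw [hg, smul_smul, div_eq_mul_inv]
  have hGF : G ≤ logisticLoss n x w := by
    unfold logisticLoss
    rw [hG]
    gcongr with i
    exact inv_exp_add_one_le_log _
  have hl : ∀ i, Real.log (1 + Real.exp (-⟪w, x i⟫_ℝ)) ≤ 1 := fun i => by
    have h1 := Finset.single_le_sum (f := fun i => Real.log (1 + Real.exp (-⟪w, x i⟫_ℝ)))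
      (fun j _ => Real.log_nonneg (by linarith [Real.exp_pos (-⟪w, x j⟫_ℝ)])) (Finset.mem_univ i)
    have h2 : (n : ℝ) * logisticLoss n x w = ∑ i, Real.log (1 + Real.exp (-⟪w, x i⟫_ℝ)) := by
      unfold logisticLoss
      field_simp
    have h3 : (n : ℝ) * logisticLoss n x w ≤ η * (1 / (8 * η)) :=
      mul_le_mul hnη hF hF0 hη.le
    have h4 : η * (1 / (8 * η)) = 1 / 8 := by field_simp
    linarith
  have hFG : logisticLoss n x w / 2 ≤ G := by
    unfold logisticLoss
    rw [hG, mul_div_assoc, Finset.sum_div]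
    gcongr with i
    exact log_div_two_le_inv_exp_add_one (hl i)
  have hgn : ‖g‖ ≤ G := by
    rw [hg, hG, norm_smul, norm_inv, RCLike.norm_natCast]
    gcongr
    refine (norm_sum_le _ _).trans (Finset.sum_le_sum fun i _ => ?_)
    rw [norm_smul, Real.norm_of_nonneg (hs0 i).le]
    exact mul_le_of_le_one_right (hs0 i).le (hx i)
  have hge : γ * G ≤ ‖g‖ := by
    have h1 : ⟪e, g⟫_ℝ = (n : ℝ)⁻¹ * ∑ i, s i * ⟪e, x i⟫_ℝ := by
      rw [hg, real_inner_smul_right, inner_sum]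
      simp only [real_inner_smul_right]
    have h2 : γ * G ≤ ⟪e, g⟫_ℝ := by
      rw [h1, hG, mul_left_comm, Finset.mul_sum]
      refine mul_le_mul_of_nonneg_left (Finset.sum_le_sum fun i _ => ?_) (by positivity)
      rw [mul_comm]
      exact mul_le_mul_of_nonneg_left (hmargin i) (hs0 i).le
    have h3 := real_inner_le_norm e g
    rw [he, one_mul] at h3
    linarith
  have hηG : η * G ≤ 1 / 8 := by
    have h1 := mul_le_mul_of_nonneg_left (hGF.trans hF) hη.le
    have h4 : η * (1 / (8 * η)) = 1 / 8 := by field_simp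
    linarith
  have hd : ∀ i, |⟪g, x i⟫_ℝ| ≤ ‖g‖ := fun i =>
    (abs_real_inner_le_norm g (x i)).trans (mul_le_of_le_one_right (norm_nonneg _) (hx i))
  have hηg : η * ‖g‖ ≤ 1 / 8 := (mul_le_mul_of_nonneg_left hgn hη.le).trans hηG
  have hgg : (n : ℝ)⁻¹ * ∑ i, s i * ⟪g, x i⟫_ℝ = ‖g‖ ^ 2 := by
    rw [← real_inner_self_eq_norm_sq]
    nth_rewrite 3 [hg]
    rw [real_inner_smul_right, inner_sum]
    simp only [real_inner_smul_right]
  have hdesc : logisticLoss n x (w + η • g) ≤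
      logisticLoss n x w - η * ‖g‖ ^ 2 + G * (η * ‖g‖) ^ 2 := by
    have h1 : logisticLoss n x (w + η • g) ≤ (n : ℝ)⁻¹ * ∑ i,
        (Real.log (1 + Real.exp (-⟪w, x i⟫_ℝ)) - η * (s i * ⟪g, x i⟫_ℝ)
          + s i * (η * ‖g‖) ^ 2) := by
      unfold logisticLoss
      gcongr with i
      rw [inner_add_left, real_inner_smul_left]
      have hdi : |η * ⟪g, x i⟫_ℝ| ≤ η * ‖g‖ := by
        rw [abs_mul, abs_of_pos hη]
        exact mul_le_mul_of_nonneg_left (hd i) hη.le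
      have h2 := log_one_add_exp_neg_add_le ⟪w, x i⟫_ℝ (d := η * ⟪g, x i⟫_ℝ) (by linarith)
      have h3 : s i * (η * ⟪g, x i⟫_ℝ) ^ 2 ≤ s i * (η * ‖g‖) ^ 2 :=
        mul_le_mul_of_nonneg_left (sq_le_sq.2 (hdi.trans (le_abs_self _))) (hs0 i).le
      have h4 : s i * (η * ⟪g, x i⟫_ℝ) = η * (s i * ⟪g, x i⟫_ℝ) := by ring
      simp only [hs] at h3 h4 ⊢
      linarith
    rw [Finset.sum_add_distrib, Finset.sum_sub_distrib, ← Finset.mul_sum, ← Finset.sum_mul,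
      mul_add, mul_sub, mul_left_comm _ η, hgg, ← mul_assoc (n : ℝ)⁻¹] at h1
    exact h1
  rw [hstep]
  have h1 : G * (η * ‖g‖) ^ 2 ≤ 1 / 8 * (η * ‖g‖ ^ 2) := by
    have : G * (η * ‖g‖) ^ 2 = (η * G) * (η * ‖g‖ ^ 2) := by ring
    rw [this]
    exact mul_le_mul_of_nonneg_right hηG (by positivity)
  have h2 : (γ * (logisticLoss n x w / 2)) ^ 2 ≤ ‖g‖ ^ 2 := by
    refine pow_le_pow_left₀ (by positivity) ?_ 2
    exact (mul_le_mul_of_nonneg_left hFG hγ.le).trans hge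
  have h3 := mul_le_mul_of_nonneg_left h2 hη.le
  have h4 : 0 ≤ η * (γ ^ 2 * logisticLoss n x w ^ 2) := by positivity
  nlinarith

theorem mul_natCast_le_one_of_quadratic_decrease {f : ℕ → ℝ} {c : ℝ} (hc : 0 ≤ c)
    (hf : ∀ k, 0 ≤ f k) (h : ∀ k, f (k + 1) ≤ f k - c * f k ^ 2) (k : ℕ) :
    k * c * f k ≤ 1 := by
  induction k with
  | zero => simp
  | succ k ih =>
    have h1 := h k
    have h2 : c * f k ≤ 1 ∨ 1 < c * f k := le_or_gt _ _
    have h3 := mul_nonneg hc (hf k)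
    rcases h2 with h2 | h2
    · have h4 : ((k : ℝ) + 1) * c * f (k + 1) ≤ ((k : ℝ) + 1) * c * (f k - c * f k ^ 2) := by
        gcongr
      push_cast
      nlinarith [mul_le_mul_of_nonneg_right ih (sub_nonneg.2 h2)]
    · nlinarith [hf k, hf (k + 1)]

/-- The step-size condition, in the form in which the transition analysis uses it. -/
theorem nine_mul_le_exp {γ η : ℝ} (hγ : 0 < γ)
    (hη : 32 / γ ^ 2 * Real.log (256 / γ ^ 2) ≤ η) (hη0 : 0 < η) :
    9 * η ≤ Real.exp (η * γ ^ 2 / 16) := by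
  have h1 : Real.log (256 / γ ^ 2) ≤ η * γ ^ 2 / 32 := by
    rw [div_mul_eq_mul_div, div_le_iff₀ (by positivity)] at hη
    linarith
  rw [Real.log_le_iff_le_exp (by positivity), div_le_iff₀ (by positivity)] at h1
  set y := η * γ ^ 2 / 32 with hy
  have h2 : Real.exp (η * γ ^ 2 / 16) = Real.exp y * Real.exp y := by
    rw [← Real.exp_add]; congr 1; rw [hy]; ring
  have hy0 : 0 < y := by positivity
  have h3 : 2 * y ≤ Real.exp y := by
    nlinarith [Real.quadratic_le_exp_of_nonneg hy0.le, sq_nonneg (y - 1)]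
  rw [h2]
  have h4 : 256 * η ≤ 32 * y * Real.exp y := by
    have h5 := mul_le_mul_of_nonneg_left h1 hη0.le
    have h6 : η * (Real.exp y * γ ^ 2) = 32 * y * Real.exp y := by rw [hy]; ring
    linarith
  nlinarith [mul_le_mul_of_nonneg_right h3 (Real.exp_pos y).le, Real.exp_pos y]

theorem exp_neg_le_div {γ η : ℝ} (hη1 : 1 ≤ η) (hγη : 1 ≤ η * γ ^ 2)
    (h : 9 * η ≤ Real.exp (η * γ ^ 2 / 16)) :
    Real.exp (-(η * γ ^ 2 / 2)) ≤ γ ^ 2 / (72 * η ^ 2) := by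
  have h1 : Real.exp (-(η * γ ^ 2 / 2)) = (Real.exp (η * γ ^ 2 / 16) ^ 8)⁻¹ := by
    rw [Real.exp_neg, ← Real.exp_nat_mul]
    congr 2
    push_cast
    ring
  rw [h1]
  have h2 : (9 * η) ^ 8 ≤ Real.exp (η * γ ^ 2 / 16) ^ 8 := by gcongr
  have h3 : 72 * η ^ 3 ≤ (9 * η) ^ 8 := by
    have : (9 * η) ^ 8 = 9 ^ 8 * η ^ 3 * η ^ 5 := by ring
    have h5 : 1 ≤ η ^ 5 := one_le_pow₀ hη1
    have h6 : 0 < η ^ 3 := by positivity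
    rw [this]
    nlinarith
  have h4 : (Real.exp (η * γ ^ 2 / 16) ^ 8)⁻¹ ≤ (72 * η ^ 3)⁻¹ :=
    inv_anti₀ (by positivity) (h3.trans h2)
  refine h4.trans ?_
  rw [inv_eq_one_div, div_le_div_iff₀ (by positivity) (by positivity)]
  nlinarith [pow_pos (by linarith : 0 < η) 2]

/-- The quarter-turn rotation of the plane. -/
noncomputable def quarterTurn (e : EuclideanSpace ℝ (Fin 2)) : EuclideanSpace ℝ (Fin 2) :=
  !₂[-e 1, e 0]

theorem norm_quarterTurn (e : EuclideanSpace ℝ (Fin 2)) : ‖quarterTurn e‖ = ‖e‖ := by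
  simp [EuclideanSpace.norm_eq, quarterTurn, Fin.sum_univ_two, add_comm]

theorem inner_eq_add_quarterTurn {e : EuclideanSpace ℝ (Fin 2)} (he : ‖e‖ = 1)
    (v y : EuclideanSpace ℝ (Fin 2)) :
    ⟪v, y⟫_ℝ = ⟪e, v⟫_ℝ * ⟪e, y⟫_ℝ + ⟪quarterTurn e, v⟫_ℝ * ⟪quarterTurn e, y⟫_ℝ := by
  have h : e 0 ^ 2 + e 1 ^ 2 = 1 := by
    have := EuclideanSpace.norm_sq_eq e
    rw [he] at this
    simp [Fin.sum_univ_two] at this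
    linarith
  simp only [PiLp.inner_apply, Fin.sum_univ_two, quarterTurn]
  simp
  linear_combination (-(v 0 * y 0 + v 1 * y 1)) * h

theorem inner_gdIter_succ (n : ℕ) (x : Fin n → EuclideanSpace ℝ (Fin 2)) {η : ℝ} (hη : η ≠ 0)
    (e : EuclideanSpace ℝ (Fin 2)) (t : ℕ) :
    ⟪e, gdIter n x η (t + 1)⟫_ℝ / η = ⟪e, gdIter n x η t⟫_ℝ / η +
      (n : ℝ)⁻¹ * ∑ i, (Real.exp ⟪gdIter n x η t, x i⟫_ℝ + 1)⁻¹ * ⟪e, x i⟫_ℝ := by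
  rw [gdIter, inner_add_right, real_inner_smul_right, inner_sum]
  simp only [real_inner_smul_right]
  field_simp

theorem gdIter_length_le {n : ℕ} (hn : 0 < n) {x : Fin n → EuclideanSpace ℝ (Fin 2)}
    (hx : ∀ i, ‖x i‖ ≤ 1) {γ η : ℝ} (hγ0 : 0 < γ) (hγ1 : γ < 1)
    {e : EuclideanSpace ℝ (Fin 2)} (he : ‖e‖ = 1) (hmargin : ∀ i, γ ≤ ⟪e, x i⟫_ℝ)
    (hnη : (n : ℝ) ≤ η) (hη : 32 / γ ^ 2 * Real.log (256 / γ ^ 2) ≤ η) {N : ℕ}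
    (hN : ∀ t, t ≤ N → 1 / (8 * η) < logisticLoss n x (gdIter n x η t)) :
    (N : ℝ) ≤ 2 + 2 / γ ^ 2 * Real.log (2 / γ ^ 2) + 4 * n / γ + 18 / γ ^ 2 := by
  have hn1 : (1 : ℝ) ≤ n := by exact_mod_cast hn
  have hη1 : 1 ≤ η := hn1.trans hnη
  have hη0 : 0 < η := by linarith
  have hγη : 1 ≤ η * γ ^ 2 := by
    have h1 : 1 ≤ Real.log (256 / γ ^ 2) := by
      rw [Real.le_log_iff_exp_le (by positivity), le_div_iff₀ (by positivity)]
      have := Real.exp_one_lt_d9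
      nlinarith
    rw [div_mul_eq_mul_div, div_le_iff₀ (by positivity)] at hη
    linarith
  set a : Fin n → ℝ := fun i => ⟪e, x i⟫_ℝ with ha
  set b : Fin n → ℝ := fun i => ⟪quarterTurn e, x i⟫_ℝ with hb
  set p : ℕ → ℝ := fun t => ⟪e, gdIter n x η t⟫_ℝ / η with hp
  set q : ℕ → ℝ := fun t => ⟪quarterTurn e, gdIter n x η t⟫_ℝ / η with hq
  have hz : ∀ t i, planarMargin a b η (p t) (q t) i = ⟪gdIter n x η t, x i⟫_ℝ := fun t i => by
    rw [inner_eq_add_quarterTurn he]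
    simp only [planarMargin, ha, hb, hp, hq]
    field_simp
  have h9 := nine_mul_le_exp hγ0 hη hη0
  have S : SeparatedPlanarData n a b γ η :=
    { n_pos := hn
      margin_le := hmargin
      abs_le_one := fun i => by
        refine (abs_real_inner_le_norm _ _).trans ?_
        rw [norm_quarterTurn, he, one_mul]
        exact hx i
      margin_pos := hγ0
      margin_lt_one := hγ1
      n_le := hnη
      one_le := hη1
      log_bound := h9
      exp_bound := exp_neg_le_div hη1 hγη h9 }
  have hp_succ : ∀ t, p (t + 1) =
      p t + (n : ℝ)⁻¹ * ∑ i, planarWeight a b η (p t) (q t) i * a i := fun t => by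
    simp only [planarWeight, hz]
    exact inner_gdIter_succ n x hη0.ne' e t
  have hq_succ : ∀ t, q (t + 1) =
      q t + (n : ℝ)⁻¹ * ∑ i, planarWeight a b η (p t) (q t) i * b i := fun t => by
    simp only [planarWeight, hz]
    exact inner_gdIter_succ n x hη0.ne' (quarterTurn e) t
  have hp0 : p 0 = 0 := by simp [hp, gdIter]
  have hq0 : q 0 = 0 := by simp [hq, gdIter]
  have hlog : 0 ≤ 2 / γ ^ 2 * Real.log (2 / γ ^ 2) := by
    refine mul_nonneg (by positivity) (Real.log_nonneg ?_)
    rw [le_div_iff₀ (by positivity)]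
    nlinarith
  rcases Nat.eq_zero_or_pos N with rfl | hNpos
  · simp only [Nat.cast_zero]
    positivity
  have R : UnfinishedRun a b γ η p q N :=
    { data := S
      p_succ := hp_succ
      q_succ := hq_succ
      p_one := by
        have h1 := S.next_ge (hp_succ 0)
        have h2 : (n : ℝ)⁻¹ * ∑ i, planarWeight a b η (p 0) (q 0) i = 1 / 2 := by
          simp only [planarWeight, planarMargin, hp0, hq0]
          simp
          norm_num
          field_simp
        rw [h2, hp0] at h1
        linarith
      q_one := by
        have h1 := S.abs_next_sub_le (hq_succ 0)
        rwa [hq0, sub_zero] at h1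
      unfinished := fun t _ ht => by
        have h1 := hN t ht
        simpa only [planarLoss, hz, logisticLoss] using h1 }
  exact R.length_le hNpos

theorem stmt_0 (n : ℕ) (hn : 0 < n) (x : Fin n → EuclideanSpace ℝ (Fin 2))
    (hx : ∀ i, ‖x i‖ ≤ 1) (γ : ℝ) (hγ0 : 0 < γ) (hγ1 : γ < 1)
    (hmm : isMaxMargin n x γ) (η : ℝ)
    (hη : max (n : ℝ) (32 / γ ^ 2 * Real.log (256 / γ ^ 2)) ≤ η) :
    ∃ τ : ℕ,
      IsLeast {t : ℕ | logisticLoss n x (gdIter n x η t) ≤ 1 / (8 * η)} τ ∧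
      (τ : ℝ) ≤ 2 + 4 * n / γ + 142 / γ ^ 2 * Real.log (2 / γ ^ 2) ∧
      (∀ t : ℕ, τ ≤ t → logisticLoss n x (gdIter n x η t) ≤ 1 / (8 * η)) ∧
      (∀ t : ℕ, τ < t →
        logisticLoss n x (gdIter n x η t) ≤ 8 / (η * γ ^ 2 * ((t : ℝ) - (τ : ℝ)))) := by
  obtain ⟨⟨e, he, hmargin⟩, -⟩ := hmm
  have hnη : (n : ℝ) ≤ η := (le_max_left _ _).trans hη
  have hη' := (le_max_right _ _).trans hη
  have hn1 : (1 : ℝ) ≤ n := by exact_mod_cast hn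
  have hη0 : 0 < η := by linarith
  have hlen := fun N => gdIter_length_le hn hx hγ0 hγ1 he hmargin hnη hη' (N := N)
  have hex : ∃ t, logisticLoss n x (gdIter n x η t) ≤ 1 / (8 * η) := by
    by_contra! h
    obtain ⟨N, hN⟩ := exists_nat_gt
      (2 + 2 / γ ^ 2 * Real.log (2 / γ ^ 2) + 4 * n / γ + 18 / γ ^ 2)
    exact absurd (hlen N fun t _ => h t) (not_le.2 hN)
  classical
  have hspec := Nat.find_spec hex
  have hmin := fun t (ht : t < Nat.find hex) => Nat.find_min hex ht
  have hleast : ∀ t, logisticLoss n x (gdIter n x η t) ≤ 1 / (8 * η) → Nat.find hex ≤ t :=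
    fun t ht => Nat.find_min' hex ht
  set τ := Nat.find hex
  have hstable : ∀ k, logisticLoss n x (gdIter n x η (τ + k)) ≤ 1 / (8 * η) := by
    intro k
    induction k with
    | zero => exact hspec
    | succ k ih =>
      have h1 := logisticLoss_step_le hn hx hγ0 he hmargin hnη _ ih
      refine le_trans h1 (le_trans ?_ ih)
      have : 0 ≤ η * γ ^ 2 / 8 * logisticLoss n x (gdIter n x η (τ + k)) ^ 2 := by positivity
      linarith
  have hquad := mul_natCast_le_one_of_quadratic_decrease
    (f := fun k => logisticLoss n x (gdIter n x η (τ + k))) (c := η * γ ^ 2 / 8) (by positivity)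
    (fun k => logisticLoss_nonneg n x _)
    (fun k => logisticLoss_step_le hn hx hγ0 he hmargin hnη _ (hstable k))
  refine ⟨τ, ⟨hspec, hleast⟩, ?_, fun t ht => ?_, fun t ht => ?_⟩
  · have hγsq : γ ^ 2 ≤ 1 := by nlinarith
    have h1 : 1 ≤ 1 / γ ^ 2 := by rwa [le_div_iff₀ (by positivity), one_mul]
    have h2 : (τ : ℝ) ≤ 3 + 2 / γ ^ 2 * Real.log (2 / γ ^ 2) + 4 * n / γ + 18 / γ ^ 2 := by
      rcases Nat.eq_zero_or_pos τ with h | h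
      · have h3 : 0 ≤ Real.log (2 / γ ^ 2) := by
          refine Real.log_nonneg ?_
          rw [le_div_iff₀ (by positivity)]
          linarith
        rw [h, Nat.cast_zero]
        positivity
      · have h3 := hlen (τ - 1) fun t ht => not_le.1 (hmin t (by omega))
        rw [Nat.cast_sub h, Nat.cast_one] at h3
        linarith
    have h3 : 1 / 2 ≤ Real.log (2 / γ ^ 2) := by
      have h4 : Real.log 2 ≤ Real.log (2 / γ ^ 2) := by
        refine Real.log_le_log (by norm_num) ?_
        rw [le_div_iff₀ (by positivity)]
        linarith
      linarith [Real.log_two_gt_d9]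
    have h5 : 140 / γ ^ 2 * (1 / 2) ≤ 140 / γ ^ 2 * Real.log (2 / γ ^ 2) := by gcongr
    have h6 : 142 / γ ^ 2 * Real.log (2 / γ ^ 2) =
        2 / γ ^ 2 * Real.log (2 / γ ^ 2) + 140 / γ ^ 2 * Real.log (2 / γ ^ 2) := by ring
    have h7 : 140 / γ ^ 2 * (1 / 2) = 18 / γ ^ 2 + 52 * (1 / γ ^ 2) := by ring
    linarith
  · obtain ⟨k, rfl⟩ := Nat.exists_eq_add_of_le ht
    exact hstable k
  · obtain ⟨k, rfl⟩ := Nat.exists_eq_add_of_le ht.le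
    have hk : (0 : ℝ) < k := by
      have : 0 < k := by omega
      exact_mod_cast this
    have h1 := hquad k
    push_cast
    rw [add_sub_cancel_left, le_div_iff₀ (by positivity)]
    linarith
end

section
/- The sequence ŵ_t = ⟨w_t, w_*⟩ is strictly increasing in t. Moreover, if η ≥ η₀ = max(n, (32/γ²)·log(256/γ²)), then: (i) for every t ≥ 1 such that F(w_s) > 1/(8η) holds for all s with 1 ≤ s < t, one has ŵ_t ≥ ηγ/2 + γ(t−1)/16; and (ii) ŵ_t ≥ 8·log(8η)/γ for all t ≥ 1. -/
open scoped InnerProductSpace BigOperators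
open Finset

/-- Gradient potential `G(w) = (1/n) ∑ᵢ 1/(exp(⟨w, xᵢ⟩) + 1)`. -/
noncomputable def gradPotential (n : ℕ) (x : Fin n → EuclideanSpace ℝ (Fin 2))
    (w : EuclideanSpace ℝ (Fin 2)) : ℝ :=
  (n : ℝ)⁻¹ * ∑ i, (Real.exp ⟪w, x i⟫_ℝ + 1)⁻¹

/-- Each step of gradient descent advances along a margin direction `v` by at least `η γ G(w_t)`. -/
theorem gdIter_inner_step {n : ℕ} {x : Fin n → EuclideanSpace ℝ (Fin 2)} {γ η : ℝ}
    {v : EuclideanSpace ℝ (Fin 2)} (hsep : ∀ i, γ ≤ ⟪v, x i⟫_ℝ) (hη : 0 < η) (t : ℕ) :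
    ⟪gdIter n x η t, v⟫_ℝ + η * γ * gradPotential n x (gdIter n x η t)
      ≤ ⟪gdIter n x η (t + 1), v⟫_ℝ := by
  rw [gdIter, inner_add_left, real_inner_smul_left, sum_inner, gradPotential]
  have h : (∑ i, (Real.exp ⟪gdIter n x η t, x i⟫_ℝ + 1)⁻¹) * γ
      ≤ ∑ i, ⟪(Real.exp ⟪gdIter n x η t, x i⟫_ℝ + 1)⁻¹ • x i, v⟫_ℝ := by
    rw [Finset.sum_mul]
    refine Finset.sum_le_sum fun i _ => ?_
    rw [real_inner_smul_left, real_inner_comm v (x i)]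
    exact mul_le_mul_of_nonneg_left (hsep i) (by positivity)
  have hc : 0 ≤ η / n := by positivity
  have h' := mul_le_mul_of_nonneg_left h hc
  refine add_le_add_right (le_trans (le_of_eq ?_) h') _
  ring

theorem gradPotential_pos {n : ℕ} (hn : 0 < n) (x : Fin n → EuclideanSpace ℝ (Fin 2))
    (w : EuclideanSpace ℝ (Fin 2)) : 0 < gradPotential n x w := by
  have : Nonempty (Fin n) := ⟨⟨0, hn⟩⟩
  exact mul_pos (by positivity) (Finset.sum_pos (fun i _ => by positivity) Finset.univ_nonempty)

theorem gradPotential_zero {n : ℕ} (hn : 0 < n) (x : Fin n → EuclideanSpace ℝ (Fin 2)) :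
    gradPotential n x 0 = 1 / 2 := by
  have : (n : ℝ) ≠ 0 := by positivity
  simp only [gradPotential, inner_zero_left, Real.exp_zero, Finset.sum_const, Finset.card_univ,
    Fintype.card_fin, nsmul_eq_mul]
  field_simp
  norm_num

theorem log_one_add_exp_neg_le {z : ℝ} (hz : 0 ≤ z) :
    Real.log (1 + Real.exp (-z)) ≤ 2 * (Real.exp z + 1)⁻¹ := by
  have h1 := Real.log_le_sub_one_of_pos (show 0 < 1 + Real.exp (-z) by positivity)
  have h2 : 1 ≤ Real.exp z := Real.one_le_exp hz
  refine h1.trans ?_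
  rw [Real.exp_neg, add_sub_cancel_left, ← div_eq_mul_inv, inv_eq_one_div,
    div_le_div_iff₀ (by positivity) (by positivity)]
  linarith

/-- A correctly classified dataset has `F ≤ 2 G`; a misclassified point forces `G ≥ 1 / (2 n)`. -/
theorem logisticLoss_le_or_le_gradPotential (n : ℕ) (x : Fin n → EuclideanSpace ℝ (Fin 2))
    (w : EuclideanSpace ℝ (Fin 2)) :
    logisticLoss n x w ≤ 2 * gradPotential n x w ∨ 1 / (2 * n) ≤ gradPotential n x w := by
  by_cases h : ∀ i, 0 ≤ ⟪w, x i⟫_ℝ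
  · left
    rw [logisticLoss, gradPotential, mul_left_comm, Finset.mul_sum (a := (2 : ℝ))]
    exact mul_le_mul_of_nonneg_left
      (Finset.sum_le_sum fun i _ => log_one_add_exp_neg_le (h i)) (by positivity)
  · right
    push Not at h
    obtain ⟨i, hi⟩ := h
    have h1 : (1 / 2 : ℝ) ≤ (Real.exp ⟪w, x i⟫_ℝ + 1)⁻¹ := by
      rw [one_div]
      have := Real.exp_le_one_iff.2 hi.le
      exact inv_anti₀ (by positivity) (by linarith)
    have h2 : (Real.exp ⟪w, x i⟫_ℝ + 1)⁻¹ ≤ ∑ j, (Real.exp ⟪w, x j⟫_ℝ + 1)⁻¹ :=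
      Finset.single_le_sum (f := fun j => (Real.exp ⟪w, x j⟫_ℝ + 1)⁻¹)
        (fun j _ => by positivity) (Finset.mem_univ i)
    calc (1 : ℝ) / (2 * n) = (n : ℝ)⁻¹ * (1 / 2) := by rw [mul_comm, ← div_div]; ring
      _ ≤ gradPotential n x w := mul_le_mul_of_nonneg_left (h1.trans h2) (by positivity)

theorem mul_log_le_of_two_mul_log_le {a η : ℝ} (ha : 0 < a) (hη : 0 < η)
    (h : 2 * a * Real.log (16 * a) ≤ η) : a * Real.log (8 * η) ≤ η := by
  have h1 : Real.log (8 * η) = Real.log (16 * a) + Real.log (η / (2 * a)) := by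
    rw [← Real.log_mul (by positivity) (by positivity)]
    congr 1
    field_simp
    norm_num
  have h2 := mul_le_mul_of_nonneg_left
    (Real.log_le_sub_one_of_pos (show 0 < η / (2 * a) by positivity)) ha.le
  have h3 : a * (η / (2 * a) - 1) = η / 2 - a := by field_simp
  rw [h1, mul_add]
  linarith

theorem stmt_2 (n : ℕ) (hn : 0 < n) (x : Fin n → EuclideanSpace ℝ (Fin 2))
    (hx : ∀ i, ‖x i‖ ≤ 1) (γ : ℝ) (hγ0 : 0 < γ) (hγ1 : γ < 1)
    (hmm : isMaxMargin n x γ)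
    (wst : EuclideanSpace ℝ (Fin 2)) (hws : ‖wst‖ = 1) (hsep : ∀ i, γ ≤ ⟪wst, x i⟫_ℝ)
    (η : ℝ) (hη0 : 0 < η) :
    StrictMono (fun t : ℕ => ⟪gdIter n x η t, wst⟫_ℝ) ∧
    (max (n : ℝ) (32 / γ ^ 2 * Real.log (256 / γ ^ 2)) ≤ η →
      (∀ t : ℕ, 1 ≤ t →
        (∀ s : ℕ, 1 ≤ s → s < t → 1 / (8 * η) < logisticLoss n x (gdIter n x η s)) →
        η * γ / 2 + γ * ((t : ℝ) - 1) / 16 ≤ ⟪gdIter n x η t, wst⟫_ℝ) ∧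
      (∀ t : ℕ, 1 ≤ t → 8 * Real.log (8 * η) / γ ≤ ⟪gdIter n x η t, wst⟫_ℝ)) := by
  have step := gdIter_inner_step (n := n) hsep hη0
  have mono : StrictMono (fun t : ℕ => ⟪gdIter n x η t, wst⟫_ℝ) := by
    refine strictMono_nat_of_lt_succ fun t => ?_
    have := mul_pos (mul_pos hη0 hγ0) (gradPotential_pos hn x (gdIter n x η t))
    linarith [step t]
  have first : η * γ / 2 ≤ ⟪gdIter n x η 1, wst⟫_ℝ := by
    have h := step 0
    rw [gdIter, gradPotential_zero hn, inner_zero_left] at h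
    simp only [zero_add] at h
    linarith
  refine ⟨mono, fun hη => ⟨fun t ht => ?_, fun t ht => ?_⟩⟩
  · induction t, ht using Nat.le_induction with
    | base =>
      intro _
      norm_num
      exact first
    | succ t ht ih =>
      intro hs
      have ih' := ih fun s h1 h2 => hs s h1 (h2.trans t.lt_succ_self)
      have hF := hs t ht t.lt_succ_self
      have hn' : (0 : ℝ) < n := by exact_mod_cast hn
      have hG : 1 / (16 * η) ≤ gradPotential n x (gdIter n x η t) := by
        rcases logisticLoss_le_or_le_gradPotential n x (gdIter n x η t) with h | h
        · have : 1 / (16 * η) = 1 / (8 * η) / 2 := by rw [div_div]; ring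
          linarith
        · refine le_trans ?_ h
          exact one_div_le_one_div_of_le (by positivity) (by linarith [(le_max_left _ _).trans hη])
      have h := mul_le_mul_of_nonneg_left hG (mul_pos hη0 hγ0).le
      have h' : η * γ * (1 / (16 * η)) = γ / 16 := by field_simp
      push_cast
      linarith [step t]
  · refine le_trans ?_ (first.trans (mono.monotone ht))
    have h := mul_log_le_of_two_mul_log_le (a := 16 / γ ^ 2) (by positivity) hη0 (by
      rw [show 2 * (16 / γ ^ 2) = 32 / γ ^ 2 by ring, show 16 * (16 / γ ^ 2) = 256 / γ ^ 2 by ring]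
      exact (le_max_right _ _).trans hη)
    rw [div_mul_eq_mul_div, div_le_iff₀ (by positivity)] at h
    rw [div_le_iff₀ hγ0]
    linarith
end

section
/- Suppose η ≥ η₀ = max(n, (32/γ²)·log(256/γ²)) and t is such that F(w_s) > 1/(8η) for all s ≤ t. Then, with B_t = {i ∈ [n] : x̃_i·w̃_t ≤ −γ·ŵ_t/2}, one has (1 − 16/η³)·G(w_t) ≤ (1/n)·∑_{i ∈ B_t} 1/(exp(⟨w_t, x_i⟩) + 1) ≤ G(w_t). -/
open scoped InnerProductSpace BigOperators
open Finset

/-- Parseval in the plane: the inner product in coordinates along two orthogonal unit vectors. -/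
lemma inner_eq_of_orthogonal_unit {u v : EuclideanSpace ℝ (Fin 2)} (hu : ‖u‖ = 1) (hv : ‖v‖ = 1)
    (hvu : ⟪v, u⟫_ℝ = 0) (a b : EuclideanSpace ℝ (Fin 2)) :
    ⟪a, b⟫_ℝ = ⟪a, u⟫_ℝ * ⟪u, b⟫_ℝ + ⟪a, v⟫_ℝ * ⟪b, v⟫_ℝ := by
  have ho : Orthonormal ℝ ![u, v] := by
    refine ⟨fun i => ?_, fun i j hij => ?_⟩
    · fin_cases i <;> simp [hu, hv]
    · fin_cases i <;> fin_cases j <;> simp_all [real_inner_comm]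
  have ho' : Orthonormal ℝ ((Set.univ : Set (Fin 2)).domRestrict ![u, v]) :=
    ho.comp _ Subtype.val_injective
  obtain ⟨c, hc⟩ := ho'.exists_orthonormalBasis_extension_of_card_eq (by simp)
  have h := c.sum_inner_mul_inner a b
  rw [Fin.sum_univ_two, hc 0 trivial, hc 1 trivial] at h
  simpa [real_inner_comm v b] using h.symm

/-- The component of the iterates along a separating direction never decreases. -/
lemma inner_gdIter_le_succ {n : ℕ} {x : Fin n → EuclideanSpace ℝ (Fin 2)}
    {u : EuclideanSpace ℝ (Fin 2)} (hu : ∀ i, 0 ≤ ⟪u, x i⟫_ℝ) {η : ℝ} (hη : 0 ≤ η) (t : ℕ) :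
    ⟪gdIter n x η t, u⟫_ℝ ≤ ⟪gdIter n x η (t + 1), u⟫_ℝ := by
  rw [gdIter, inner_add_left, real_inner_smul_left, sum_inner]
  refine le_add_of_nonneg_right (mul_nonneg (by positivity) (sum_nonneg fun i _ => ?_))
  rw [real_inner_smul_left, real_inner_comm u]
  exact mul_nonneg (by positivity) (hu i)

lemma le_inner_gdIter_succ {n : ℕ} (hn : 0 < n) {x : Fin n → EuclideanSpace ℝ (Fin 2)}
    {γ : ℝ} (hγ : 0 ≤ γ) {u : EuclideanSpace ℝ (Fin 2)} (hu : ∀ i, γ ≤ ⟪u, x i⟫_ℝ)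
    {η : ℝ} (hη : 0 ≤ η) (t : ℕ) :
    η * γ / 2 ≤ ⟪gdIter n x η (t + 1), u⟫_ℝ := by
  induction t with
  | zero =>
    have hn' : (0 : ℝ) < n := by exact_mod_cast hn
    have hsum : (n : ℝ) * (γ / 2) ≤
        ⟪∑ i, (Real.exp ⟪gdIter n x η 0, x i⟫_ℝ + 1)⁻¹ • x i, u⟫_ℝ := by
      rw [sum_inner]
      calc (n : ℝ) * (γ / 2) = ∑ _i : Fin n, γ / 2 := by simp
        _ ≤ _ := sum_le_sum fun i _ => by
          rw [real_inner_smul_left, real_inner_comm u, gdIter, inner_zero_left, Real.exp_zero]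
          linarith [hu i]
    rw [gdIter, inner_add_left, real_inner_smul_left]
    calc η * γ / 2 = η / n * (n * (γ / 2)) := by field_simp
      _ ≤ η / n * _ := mul_le_mul_of_nonneg_left hsum (by positivity)
      _ ≤ _ := by simp [gdIter]
  | succ t ih => exact ih.trans (inner_gdIter_le_succ (fun i => hγ.trans (hu i)) hη _)

/-- A loss above `1 / (8η)` forces the gradient potential to be at least `1 / (9η²)`. -/
lemma le_gradPotential_of_lt_logisticLoss {n : ℕ} (hn : 0 < n)
    {x : Fin n → EuclideanSpace ℝ (Fin 2)} {w : EuclideanSpace ℝ (Fin 2)} {η : ℝ}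
    (hnη : (n : ℝ) ≤ η) (h : 1 / (8 * η) < logisticLoss n x w) :
    1 / (9 * η ^ 2) ≤ gradPotential n x w := by
  have hn1 : (1 : ℝ) ≤ n := by exact_mod_cast hn
  have hn' : (0 : ℝ) < n := by linarith
  have hη : 0 < η := by linarith
  obtain ⟨i, hi⟩ : ∃ i, 1 / (8 * η) < Real.log (1 + Real.exp (-⟪w, x i⟫_ℝ)) := by
    by_contra! hall
    refine h.not_ge ?_
    calc logisticLoss n x w ≤ (n : ℝ)⁻¹ * ∑ _i : Fin n, 1 / (8 * η) :=
          mul_le_mul_of_nonneg_left (sum_le_sum fun i _ => hall i) (by positivity)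
      _ = 1 / (8 * η) := by
          rw [sum_const, card_univ, Fintype.card_fin, nsmul_eq_mul, inv_mul_cancel_left₀ hn'.ne']
  have hlog := Real.log_le_sub_one_of_pos
    (show 0 < 1 + Real.exp (-⟪w, x i⟫_ℝ) by positivity)
  have hexp : Real.exp ⟪w, x i⟫_ℝ ≤ 8 * η := by
    have h1 : 1 / (8 * η) < 1 / Real.exp ⟪w, x i⟫_ℝ := by
      rw [one_div (Real.exp _), ← Real.exp_neg]; linarith
    exact (lt_of_one_div_lt_one_div (by positivity) h1).le
  calc 1 / (9 * η ^ 2) = η⁻¹ * (9 * η)⁻¹ := by field_simp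
    _ ≤ (n : ℝ)⁻¹ * (Real.exp ⟪w, x i⟫_ℝ + 1)⁻¹ := by
        gcongr
        linarith
    _ ≤ gradPotential n x w :=
        mul_le_mul_of_nonneg_left
          (single_le_sum (f := fun i => (Real.exp ⟪w, x i⟫_ℝ + 1)⁻¹)
            (fun j _ => by positivity) (mem_univ i)) (by positivity)

lemma exp_neg_mul_le_of_le {γ η : ℝ} (hγ : 0 < γ) (hη : 1 ≤ η)
    (h : 32 / γ ^ 2 * Real.log (256 / γ ^ 2) ≤ η) :
    Real.exp (-(γ ^ 2 * η / 4)) ≤ 16 / (9 * η ^ 5) := by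
  set u := γ ^ 2 * η / 32 with hu
  have hu0 : 0 ≤ u := by positivity
  have hlog : Real.log (256 / γ ^ 2) ≤ u := by
    calc Real.log (256 / γ ^ 2)
        = γ ^ 2 / 32 * (32 / γ ^ 2 * Real.log (256 / γ ^ 2)) := by field_simp
      _ ≤ γ ^ 2 / 32 * η := by gcongr
      _ = u := by rw [hu]; ring
  set y := Real.exp (u / 2) with hy
  have hy1 : 1 ≤ y := Real.one_le_exp (by positivity)
  have hbase : 256 / γ ^ 2 ≤ y ^ 2 := by
    rw [hy, ← Real.exp_nat_mul]
    calc 256 / γ ^ 2 = Real.exp (Real.log (256 / γ ^ 2)) := (Real.exp_log (by positivity)).symm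
      _ ≤ _ := Real.exp_le_exp.2 (by push_cast; linarith)
  have huy : u ≤ 2 * y := by
    have := Real.add_one_le_exp (u / 2)
    linarith
  have hηy : η ≤ y ^ 3 / 4 := by
    calc η = 256 / γ ^ 2 * (u / 8) := by rw [hu]; field_simp; norm_num
      _ ≤ y ^ 2 * (2 * y / 8) := by gcongr
      _ = y ^ 3 / 4 := by ring
  have hexp : Real.exp (-(γ ^ 2 * η / 4)) = 1 / y ^ 16 := by
    rw [hy, ← Real.exp_nat_mul, Real.exp_neg, one_div]
    congr 2
    rw [hu]; push_cast; ring
  rw [hexp, div_le_div_iff₀ (by positivity) (by positivity)]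
  calc 1 * (9 * η ^ 5) ≤ 1 * (9 * (y ^ 3 / 4) ^ 5) := by gcongr
    _ = 9 / 1024 * y ^ 15 := by ring
    _ ≤ 16 * y ^ 16 := by
      gcongr <;> norm_num

theorem stmt_4 (n : ℕ) (hn : 0 < n) (x : Fin n → EuclideanSpace ℝ (Fin 2))
    (hx : ∀ i, ‖x i‖ ≤ 1) (γ : ℝ) (hγ0 : 0 < γ) (hγ1 : γ < 1)
    (hmm : isMaxMargin n x γ)
    (wst : EuclideanSpace ℝ (Fin 2)) (hws : ‖wst‖ = 1) (hsep : ∀ i, γ ≤ ⟪wst, x i⟫_ℝ)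
    (vst : EuclideanSpace ℝ (Fin 2)) (hvs : ‖vst‖ = 1) (hvw : ⟪vst, wst⟫_ℝ = 0)
    (η : ℝ) (hη : max (n : ℝ) (32 / γ ^ 2 * Real.log (256 / γ ^ 2)) ≤ η)
    (t : ℕ) (ht : ∀ s : ℕ, s ≤ t → 1 / (8 * η) < logisticLoss n x (gdIter n x η s)) :
    (1 - 16 / η ^ 3) * gradPotential n x (gdIter n x η t) ≤
      (n : ℝ)⁻¹ * ∑ i ∈ Finset.univ.filter
          (fun i => ⟪x i, vst⟫_ℝ * ⟪gdIter n x η t, vst⟫_ℝ ≤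
            -(γ * ⟪gdIter n x η t, wst⟫_ℝ / 2)),
        (Real.exp ⟪gdIter n x η t, x i⟫_ℝ + 1)⁻¹ ∧
    (n : ℝ)⁻¹ * ∑ i ∈ Finset.univ.filter
          (fun i => ⟪x i, vst⟫_ℝ * ⟪gdIter n x η t, vst⟫_ℝ ≤
            -(γ * ⟪gdIter n x η t, wst⟫_ℝ / 2)),
        (Real.exp ⟪gdIter n x η t, x i⟫_ℝ + 1)⁻¹ ≤
      gradPotential n x (gdIter n x η t) := by
  have hnη : (n : ℝ) ≤ η := (le_max_left _ _).trans hη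
  have hn1 : (1 : ℝ) ≤ n := by exact_mod_cast hn
  have hn' : (0 : ℝ) < n := by linarith
  have hη1 : 1 ≤ η := hn1.trans hnη
  have hη0 : 0 < η := by linarith
  set w := gdIter n x η t with hw
  refine ⟨?_, mul_le_mul_of_nonneg_left
    (sum_le_sum_of_subset_of_nonneg (filter_subset _ _) fun i _ _ => by positivity)
    (by positivity)⟩
  have hsmall : Real.exp (-(γ ^ 2 * η / 4)) ≤ 16 / η ^ 3 * gradPotential n x w :=
    calc Real.exp (-(γ ^ 2 * η / 4)) ≤ 16 / (9 * η ^ 5) :=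
          exp_neg_mul_le_of_le hγ0 hη1 ((le_max_right _ _).trans hη)
      _ = 16 / η ^ 3 * (1 / (9 * η ^ 2)) := by field_simp
      _ ≤ _ := mul_le_mul_of_nonneg_left
          (le_gradPotential_of_lt_logisticLoss hn hnη (ht t le_rfl)) (by positivity)
  have hrest : ∀ i, ¬ ⟪x i, vst⟫_ℝ * ⟪w, vst⟫_ℝ ≤ -(γ * ⟪w, wst⟫_ℝ / 2) →
      (Real.exp ⟪w, x i⟫_ℝ + 1)⁻¹ ≤ Real.exp (-(γ ^ 2 * η / 4)) := by
    intro i hi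
    obtain _ | k := t
    · simp [hw, gdIter] at hi
    have hwst : η * γ / 2 ≤ ⟪w, wst⟫_ℝ := le_inner_gdIter_succ hn hγ0.le hsep hη0.le k
    have hmargin : γ ^ 2 * η / 4 ≤ ⟪w, x i⟫_ℝ := by
      have hpos : 0 ≤ ⟪w, wst⟫_ℝ := le_trans (by positivity) hwst
      have h1 := mul_le_mul_of_nonneg_left (hsep i) hpos
      have h2 := mul_le_mul_of_nonneg_left hwst hγ0.le
      rw [inner_eq_of_orthogonal_unit hws hvs hvw w (x i)]
      push Not at hi
      linarith
    rw [Real.exp_neg]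
    gcongr
    linarith [Real.exp_le_exp.2 hmargin]
  have hcompl : (n : ℝ)⁻¹ * ∑ i with ¬ ⟪x i, vst⟫_ℝ * ⟪w, vst⟫_ℝ ≤ -(γ * ⟪w, wst⟫_ℝ / 2),
      (Real.exp ⟪w, x i⟫_ℝ + 1)⁻¹ ≤ Real.exp (-(γ ^ 2 * η / 4)) := by
    rw [inv_mul_le_iff₀ hn']
    calc _ ≤ _ := sum_le_card_nsmul _ _ _ fun i hi => hrest i (mem_filter.1 hi).2
      _ ≤ (n : ℝ) * Real.exp (-(γ ^ 2 * η / 4)) := by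
          rw [nsmul_eq_mul]
          gcongr
          simpa using card_filter_le (univ : Finset (Fin n)) _
  have hsplit : gradPotential n x w = _ :=
    congrArg ((n : ℝ)⁻¹ * ·) (sum_filter_add_sum_filter_not univ
      (fun i => ⟪x i, vst⟫_ℝ * ⟪w, vst⟫_ℝ ≤ -(γ * ⟪w, wst⟫_ℝ / 2))
      fun i => (Real.exp ⟪w, x i⟫_ℝ + 1)⁻¹).symm
  rw [mul_add] at hsplit
  linarith
end

section
/- Suppose η ≥ η₀ = max(n, (32/γ²)·log(256/γ²)) and an oscillation happens at iteration t, i.e. ŵ_t ≥ λ, F(w_t) > 1/(8η), F(w_{t+1}) > 1/(8η), and w̃_{t+1}·w̃_t < 0. Then ŵ_t ≤ η/γ. -/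
open scoped InnerProductSpace BigOperators
open Finset

/-- The threshold `λ = log(1/(exp(1/(8η)) − 1))/γ`. -/
noncomputable def lambdaThresh (γ η : ℝ) : ℝ :=
  Real.log (1 / (Real.exp (1 / (8 * η)) - 1)) / γ

/-- An oscillation occurs at iteration `t` if `ŵ_t ≥ λ`, `F(w_t) > 1/(8η)`,
`F(w_{t+1}) > 1/(8η)`, and `w̃_{t+1}·w̃_t < 0`. -/
def oscillationAt (n : ℕ) (x : Fin n → EuclideanSpace ℝ (Fin 2)) (γ η : ℝ)
    (wst vst : EuclideanSpace ℝ (Fin 2)) (t : ℕ) : Prop :=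
  lambdaThresh γ η ≤ ⟪gdIter n x η t, wst⟫_ℝ ∧
  1 / (8 * η) < logisticLoss n x (gdIter n x η t) ∧
  1 / (8 * η) < logisticLoss n x (gdIter n x η (t + 1)) ∧
  ⟪gdIter n x η (t + 1), vst⟫_ℝ * ⟪gdIter n x η t, vst⟫_ℝ < 0

/-- Parseval's identity for inner products in the plane, for a pair of orthogonal unit vectors. -/
theorem inner_eq_of_orthonormal_pair (u v : EuclideanSpace ℝ (Fin 2)) (hu : ‖u‖ = 1)
    (hv : ‖v‖ = 1) (hvu : ⟪v, u⟫_ℝ = 0) (a b : EuclideanSpace ℝ (Fin 2)) :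
    ⟪a, b⟫_ℝ = ⟪a, u⟫_ℝ * ⟪u, b⟫_ℝ + ⟪a, v⟫_ℝ * ⟪v, b⟫_ℝ := by
  have ho : Orthonormal ℝ ![u, v] := by
    have huv : ⟪u, v⟫_ℝ = 0 := by rw [real_inner_comm, hvu]
    simp [orthonormal_vecCons_iff, hu, hv, huv]
  let B := OrthonormalBasis.mk ho (by
    have h := (basisOfOrthonormalOfCardEqFinrank ho (by simp)).span_eq
    rw [coe_basisOfOrthonormalOfCardEqFinrank] at h
    exact h.ge)
  have h := B.sum_inner_mul_inner a b
  simp only [B, OrthonormalBasis.coe_mk, Fin.sum_univ_two] at h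
  simpa using h.symm

/-- A step size above the threshold satisfies `8η ≤ exp(ηγ²)`. -/
theorem eight_mul_le_exp {γ η : ℝ} (hγ0 : 0 < γ) (hγ1 : γ < 1)
    (hη : 32 / γ ^ 2 * Real.log (256 / γ ^ 2) ≤ η) : 8 * η ≤ Real.exp (η * γ ^ 2) := by
  have hγ2 : 0 < γ ^ 2 := by positivity
  have hq : 1 < 256 / γ ^ 2 := by rw [one_lt_div hγ2]; nlinarith
  have hL : 0 < Real.log (256 / γ ^ 2) := Real.log_pos hq
  have hz : 32 * Real.log (256 / γ ^ 2) ≤ η * γ ^ 2 := by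
    rw [div_mul_eq_mul_div, div_le_iff₀ hγ2] at hη
    exact hη
  have h1 : 256 / γ ^ 2 ≤ Real.exp (η * γ ^ 2 / 2) := by
    rw [← Real.log_le_iff_le_exp (by linarith)]
    linarith
  have h2 : η * γ ^ 2 / 2 ≤ Real.exp (η * γ ^ 2 / 2) := by
    linarith [Real.add_one_le_exp (η * γ ^ 2 / 2)]
  have hη0 : 0 ≤ η := le_of_mul_le_mul_right (by linarith) hγ2
  calc 8 * η ≤ 128 * η := by linarith
    _ = 256 / γ ^ 2 * (η * γ ^ 2 / 2) := by field_simp; ring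
    _ ≤ Real.exp (η * γ ^ 2 / 2) * Real.exp (η * γ ^ 2 / 2) := by gcongr
    _ = Real.exp (η * γ ^ 2) := by rw [← Real.exp_add]; ring_nf

/-- The loss is at most `exp(-m)` if all margins are at least `m`. -/
theorem logisticLoss_le_exp_neg {n : ℕ} (hn : 0 < n) (x : Fin n → EuclideanSpace ℝ (Fin 2))
    (w : EuclideanSpace ℝ (Fin 2)) (m : ℝ) (h : ∀ i, m ≤ ⟪w, x i⟫_ℝ) :
    logisticLoss n x w ≤ Real.exp (-m) := by
  have hn' : (0 : ℝ) < n := by exact_mod_cast hn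
  have hs : ∑ i, Real.log (1 + Real.exp (-⟪w, x i⟫_ℝ)) ≤ ∑ _i : Fin n, Real.exp (-m) := by
    refine Finset.sum_le_sum fun i _ => ?_
    have h1 := Real.log_le_sub_one_of_pos (x := 1 + Real.exp (-⟪w, x i⟫_ℝ)) (by positivity)
    have h2 : Real.exp (-⟪w, x i⟫_ℝ) ≤ Real.exp (-m) := Real.exp_le_exp.2 (by linarith [h i])
    linarith
  rw [Finset.sum_const, Finset.card_univ, Fintype.card_fin, nsmul_eq_mul] at hs
  rw [logisticLoss, inv_mul_le_iff₀ hn']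
  exact hs

/-- One gradient step changes the component along `v` by at most `η` times a bound on the
components of the data along `v`. -/
theorem abs_inner_gdIter_succ_sub_le {n : ℕ} (hn : 0 < n) (x : Fin n → EuclideanSpace ℝ (Fin 2))
    {η : ℝ} (hη : 0 ≤ η) (v : EuclideanSpace ℝ (Fin 2)) (s : ℝ)
    (hs : ∀ i, |⟪x i, v⟫_ℝ| ≤ s) (t : ℕ) :
    |⟪gdIter n x η (t + 1), v⟫_ℝ - ⟪gdIter n x η t, v⟫_ℝ| ≤ η * s := by
  have hn' : (0 : ℝ) < n := by exact_mod_cast hn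
  have h : |∑ i, (Real.exp ⟪gdIter n x η t, x i⟫_ℝ + 1)⁻¹ * ⟪x i, v⟫_ℝ| ≤ n * s := by
    refine (Finset.abs_sum_le_sum_abs _ _).trans ?_
    refine (Finset.sum_le_card_nsmul _ _ s fun i _ => ?_).trans (by simp)
    rw [abs_mul]
    have h0 : |(Real.exp ⟪gdIter n x η t, x i⟫_ℝ + 1)⁻¹| ≤ 1 := by
      rw [abs_of_pos (by positivity)]
      exact inv_le_one_of_one_le₀ (by linarith [Real.exp_pos ⟪gdIter n x η t, x i⟫_ℝ])
    exact (mul_le_of_le_one_left (abs_nonneg _) h0).trans (hs i)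
  rw [gdIter, inner_add_left, add_sub_cancel_left, real_inner_smul_left, sum_inner]
  simp only [real_inner_smul_left]
  rw [abs_mul, abs_of_nonneg (by positivity)]
  calc η / n * _ ≤ η / n * (n * s) := by gcongr
    _ = η * s := by field_simp

theorem stmt_6 (n : ℕ) (hn : 0 < n) (x : Fin n → EuclideanSpace ℝ (Fin 2))
    (hx : ∀ i, ‖x i‖ ≤ 1) (γ : ℝ) (hγ0 : 0 < γ) (hγ1 : γ < 1)
    (hmm : isMaxMargin n x γ)
    (wst : EuclideanSpace ℝ (Fin 2)) (hws : ‖wst‖ = 1) (hsep : ∀ i, γ ≤ ⟪wst, x i⟫_ℝ)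
    (vst : EuclideanSpace ℝ (Fin 2)) (hvs : ‖vst‖ = 1) (hvw : ⟪vst, wst⟫_ℝ = 0)
    (η : ℝ) (hη : max (n : ℝ) (32 / γ ^ 2 * Real.log (256 / γ ^ 2)) ≤ η)
    (t : ℕ) (hosc : oscillationAt n x γ η wst vst t) :
    ⟪gdIter n x η t, wst⟫_ℝ ≤ η / γ := by
  obtain ⟨-, hF, -, hsign⟩ := hosc
  by_contra! hbig
  have hη1 : (1 : ℝ) ≤ η := by
    have : (1 : ℝ) ≤ n := by exact_mod_cast hn
    exact this.trans ((le_max_left _ _).trans hη)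
  have hexp := eight_mul_le_exp hγ0 hγ1 ((le_max_right _ _).trans hη)
  have hpar := inner_eq_of_orthonormal_pair wst vst hws hvs hvw
  have hb : ∀ i, |⟪x i, vst⟫_ℝ| ≤ √(1 - γ ^ 2) := by
    intro i
    refine Real.abs_le_sqrt ?_
    have h1 := hpar (x i) (x i)
    rw [real_inner_self_eq_norm_sq, real_inner_comm wst (x i), real_inner_comm vst (x i)] at h1
    have h2 := hx i
    have h3 := hsep i
    rw [real_inner_comm vst (x i)]
    nlinarith [norm_nonneg (x i)]
  have hstep := abs_inner_gdIter_succ_sub_le hn x (by linarith : (0 : ℝ) ≤ η) vst _ hb t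
  have hw : |⟪gdIter n x η t, vst⟫_ℝ| ≤ η * √(1 - γ ^ 2) := by
    refine le_trans (sq_le_sq.1 ?_) hstep
    nlinarith [sq_nonneg ⟪gdIter n x η (t + 1), vst⟫_ℝ]
  have hmargin : ∀ i, η * γ ^ 2 ≤ ⟪gdIter n x η t, x i⟫_ℝ := by
    intro i
    rw [hpar, real_inner_comm (x i) vst]
    have h1 : η ≤ ⟪gdIter n x η t, wst⟫_ℝ * ⟪wst, x i⟫_ℝ := by
      calc η = η / γ * γ := by field_simp
        _ ≤ _ := by
          have := hsep i
          gcongr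
          exact le_trans (by positivity) hbig.le
    have h2 : |⟪gdIter n x η t, vst⟫_ℝ * ⟪x i, vst⟫_ℝ| ≤ η * (1 - γ ^ 2) := by
      rw [abs_mul]
      calc _ ≤ η * √(1 - γ ^ 2) * √(1 - γ ^ 2) := by
            have := hb i
            gcongr
        _ = η * (1 - γ ^ 2) := by rw [mul_assoc, Real.mul_self_sqrt (by nlinarith)]
    linarith [neg_abs_le (⟪gdIter n x η t, vst⟫_ℝ * ⟪x i, vst⟫_ℝ)]
  have hle := logisticLoss_le_exp_neg hn x _ _ hmargin
  have hinv : Real.exp (-(η * γ ^ 2)) ≤ 1 / (8 * η) := by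
    rw [Real.exp_neg, one_div]
    gcongr
  linarith
end
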